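/- arXiv:1812.02421 — 4 statements merged into one kernel-verified Lean document; each statement's English description precedes it below -/
import Mathlib

section
/- Fix t > 0 and let G(x) = (√t / π) ∫_0^∞ e^{-x²/(4τ)} / (√τ (t + τ) √(4πτ)) dτ for x > 0. Then G exhibits logarithmic growth at the origin: lim_{x→0+} G(x) · 2 π^{3/2} √t / (ln(4t) − ln(x²)) = 1; in particular G(x) → +∞ as x → 0+. -/
open Real MeasureTheory Filter

theorem integrableOn_and_integral_Ioi_div_mul_add {s t : ℝ} (hs : 0 < s) (ht : 0 < t) :
    IntegrableOn (fun τ => t / (τ * (t + τ))) (Set.Ioi s) ∧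
      ∫ τ in Set.Ioi s, t / (τ * (t + τ)) = log ((t + s) / s) := by
  have hderiv : ∀ τ ∈ Set.Ici s,
      HasDerivAt (fun τ => -log (1 + t * τ⁻¹)) (t / (τ * (t + τ))) τ := by
    intro τ hτ
    have hτ0 : 0 < τ := hs.trans_le hτ
    have h1 : 0 < 1 + t * τ⁻¹ := by positivity
    refine ((((hasDerivAt_inv hτ0.ne').const_mul t).const_add 1).log h1.ne').neg.congr_deriv ?_
    field_simp
    ring
  have hnonneg : ∀ τ ∈ Set.Ioi s, 0 ≤ t / (τ * (t + τ)) := by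
    intro τ hτ
    have hτ0 : 0 < τ := hs.trans hτ
    positivity
  have hlim : Tendsto (fun τ => -log (1 + t * τ⁻¹)) atTop (nhds 0) := by
    have h := (tendsto_inv_atTop_zero (𝕜 := ℝ)).const_mul t |>.const_add 1
    have h' := (h.log (by simp)).neg
    simpa using h'
  refine ⟨integrableOn_Ioi_deriv_of_nonneg' hderiv hnonneg hlim, ?_⟩
  rw [integral_Ioi_of_hasDerivAt_of_nonneg' hderiv hnonneg hlim]
  have : (t + s) / s = 1 + t * s⁻¹ := by field_simp; ring
  rw [this]
  ring

theorem integrableOn_and_integral_Ioi_div_sq {s : ℝ} (hs : 0 < s) :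
    IntegrableOn (fun τ => s / τ ^ 2) (Set.Ioi s) ∧ ∫ τ in Set.Ioi s, s / τ ^ 2 = 1 := by
  have hderiv : ∀ τ ∈ Set.Ici s, HasDerivAt (fun τ => -(s * τ⁻¹)) (s / τ ^ 2) τ := by
    intro τ hτ
    have hτ0 : 0 < τ := hs.trans_le hτ
    refine ((hasDerivAt_inv hτ0.ne').const_mul s).neg.congr_deriv ?_
    field_simp
  have hnonneg : ∀ τ ∈ Set.Ioi s, 0 ≤ s / τ ^ 2 := fun τ _ => by positivity
  have hlim : Tendsto (fun τ => -(s * τ⁻¹)) atTop (nhds 0) := by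
    simpa using ((tendsto_inv_atTop_zero (𝕜 := ℝ)).const_mul s).neg
  refine ⟨integrableOn_Ioi_deriv_of_nonneg' hderiv hnonneg hlim, ?_⟩
  rw [integral_Ioi_of_hasDerivAt_of_nonneg' hderiv hnonneg hlim]
  field_simp
  ring

theorem abs_integral_exp_neg_div_sub_log_le {s t : ℝ} (hs : 0 < s) (ht : 0 < t) :
    |(∫ τ in Set.Ioi (0 : ℝ), exp (-s / τ) * (t / (τ * (t + τ)))) - log ((t + s) / s)| ≤ 1 := by
  obtain ⟨hint, hval⟩ := integrableOn_and_integral_Ioi_div_mul_add hs ht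
  obtain ⟨hint_sq, hval_sq⟩ := integrableOn_and_integral_Ioi_div_sq hs
  set K : ℝ → ℝ := fun τ => exp (-s / τ) * (t / (τ * (t + τ))) with hK
  have hmeas : Measurable K := by fun_prop
  have hK_nonneg : ∀ τ, 0 < τ → 0 ≤ K τ := fun τ hτ => by simp only [hK]; positivity
  have hK_le_near : ∀ τ, 0 < τ → K τ ≤ 1 / s := by
    intro τ hτ
    have h1 : exp (-s / τ) ≤ τ / s := by
      have h2 : s / τ ≤ exp (s / τ) := by linarith [add_one_le_exp (s / τ)]
      rw [neg_div, exp_neg, ← inv_div s τ]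
      exact inv_anti₀ (by positivity) h2
    calc K τ ≤ τ / s * (t / (τ * (t + τ))) := by simp only [hK]; gcongr
      _ = 1 / s * (t / (t + τ)) := by field_simp
      _ ≤ 1 / s * 1 := by
        gcongr
        rw [div_le_one (by positivity)]
        linarith
      _ = 1 / s := mul_one _
  have hK_le_far : ∀ τ ∈ Set.Ioi s, K τ ≤ t / (τ * (t + τ)) := by
    intro τ hτ
    have hτ0 : 0 < τ := hs.trans hτ
    refine mul_le_of_le_one_left (by positivity) (exp_le_one_iff.2 ?_)
    rw [neg_div]
    exact neg_nonpos.2 (by positivity)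
  have hle_K_far : ∀ τ ∈ Set.Ioi s, t / (τ * (t + τ)) - s / τ ^ 2 ≤ K τ := by
    intro τ hτ
    have hτ0 : 0 < τ := hs.trans hτ
    have h1 : 1 - s / τ ≤ exp (-s / τ) := by
      have := add_one_le_exp (-s / τ)
      rw [neg_div] at this ⊢
      linarith
    have h2 : t / (τ * (t + τ)) ≤ 1 / τ := by
      rw [div_le_div_iff₀ (by positivity) hτ0]
      nlinarith
    calc t / (τ * (t + τ)) - s / τ ^ 2 = t / (τ * (t + τ)) - s / τ * (1 / τ) := by
          field_simp
      _ ≤ t / (τ * (t + τ)) - s / τ * (t / (τ * (t + τ))) := by gcongr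
      _ = (1 - s / τ) * (t / (τ * (t + τ))) := by ring
      _ ≤ K τ := by simp only [hK]; gcongr
  have hconst : IntegrableOn (fun _ : ℝ => 1 / s) (Set.Ioc 0 s) :=
    integrableOn_const (by simp)
  have hK_near : IntegrableOn K (Set.Ioc 0 s) := by
    refine Integrable.mono' hconst hmeas.aestronglyMeasurable ?_
    filter_upwards [ae_restrict_mem measurableSet_Ioc] with τ hτ
    rw [norm_of_nonneg (hK_nonneg τ hτ.1)]
    exact hK_le_near τ hτ.1
  have hK_far : IntegrableOn K (Set.Ioi s) := by
    refine Integrable.mono' hint hmeas.aestronglyMeasurable ?_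
    filter_upwards [ae_restrict_mem measurableSet_Ioi] with τ hτ
    rw [norm_of_nonneg (hK_nonneg τ (hs.trans hτ))]
    exact hK_le_far τ hτ
  have hsplit : ∫ τ in Set.Ioi 0, K τ = (∫ τ in Set.Ioc 0 s, K τ) + ∫ τ in Set.Ioi s, K τ := by
    rw [← Set.Ioc_union_Ioi_eq_Ioi hs.le]
    exact setIntegral_union (Set.Ioc_disjoint_Ioi le_rfl) measurableSet_Ioi hK_near hK_far
  have hnear_nonneg : 0 ≤ ∫ τ in Set.Ioc 0 s, K τ :=
    setIntegral_nonneg measurableSet_Ioc fun τ hτ => hK_nonneg τ hτ.1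
  have hnear_le : ∫ τ in Set.Ioc 0 s, K τ ≤ 1 := by
    refine (setIntegral_mono_on hK_near hconst measurableSet_Ioc
      fun τ hτ => hK_le_near τ hτ.1).trans_eq ?_
    simp [hs.le, hs.ne']
  have hfar_le : ∫ τ in Set.Ioi s, K τ ≤ log ((t + s) / s) :=
    (setIntegral_mono_on hK_far hint measurableSet_Ioi hK_le_far).trans_eq hval
  have hle_far : log ((t + s) / s) - 1 ≤ ∫ τ in Set.Ioi s, K τ := by
    rw [← hval, ← hval_sq, ← integral_sub hint hint_sq]
    exact setIntegral_mono_on (hint.sub hint_sq) hK_far measurableSet_Ioi hle_K_far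
  rw [hsplit, abs_le]
  constructor <;> linarith

theorem abs_log_add_div_sub_log_le {s t : ℝ} (hs : 0 < s) (ht : 0 < t) :
    |log ((t + s) / s) - log (t / s)| ≤ s / t := by
  rw [← log_div (by positivity) (by positivity)]
  have h : (t + s) / s / (t / s) = 1 + s / t := by field_simp
  have h0 : 0 < s / t := by positivity
  rw [h, abs_of_nonneg (log_nonneg (by linarith))]
  linarith [log_le_sub_one_of_pos (show 0 < 1 + s / t by positivity)]

theorem green_half_1d_mul_eq {t x : ℝ} (ht : 0 < t) :
    ((√t / π) * ∫ τ in Set.Ioi (0 : ℝ),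
        exp (-x ^ 2 / (4 * τ)) / (√τ * (t + τ) * √(4 * π * τ))) * 2 * π ^ (3 / 2 : ℝ) * √t =
      ∫ τ in Set.Ioi (0 : ℝ), exp (-(x ^ 2 / 4) / τ) * (t / (τ * (t + τ))) := by
  have hpow : π ^ (3 / 2 : ℝ) = π * √π := by
    rw [show (3 / 2 : ℝ) = 1 + 1 / 2 by norm_num, rpow_add pi_pos, rpow_one, sqrt_eq_rpow]
  have hcongr : ∫ τ in Set.Ioi (0 : ℝ),
        exp (-x ^ 2 / (4 * τ)) / (√τ * (t + τ) * √(4 * π * τ)) =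
      ∫ τ in Set.Ioi (0 : ℝ),
        (1 / (2 * √π * t)) * (exp (-(x ^ 2 / 4) / τ) * (t / (τ * (t + τ)))) := by
    refine setIntegral_congr_fun measurableSet_Ioi fun τ hτ => ?_
    have hτ0 : 0 < τ := hτ
    have hsqrt : √(4 * π * τ) = 2 * √π * √τ := by
      rw [sqrt_mul (by positivity), sqrt_mul (by positivity),
        show (4 : ℝ) = 2 ^ 2 by norm_num, sqrt_sq (by norm_num)]
    have hexp : -x ^ 2 / (4 * τ) = -(x ^ 2 / 4) / τ := by field_simp
    have hmul : √τ * (t + τ) * (2 * √π * √τ) = 2 * √π * (τ * (t + τ)) := by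
      linear_combination (2 * √π * (t + τ)) * mul_self_sqrt hτ0.le
    simp only [hsqrt, hexp, hmul]
    field_simp
  rw [hcongr, integral_const_mul, hpow]
  have hsq : √t ^ 2 = t := sq_sqrt ht.le
  have hπ : 0 < √π := sqrt_pos.2 pi_pos
  field_simp
  rw [hsq]

theorem tendsto_log_four_mul_sub_log_sq (t : ℝ) :
    Tendsto (fun x : ℝ => log (4 * t) - log (x ^ 2)) (nhdsWithin 0 (Set.Ioi 0)) atTop := by
  simp only [sub_eq_add_neg, log_pow, Nat.cast_ofNat]
  refine tendsto_atTop_add_const_left _ _ (tendsto_neg_atBot_atTop.comp ?_)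
  exact tendsto_log_nhdsGT_zero.const_mul_atBot two_pos

theorem eventually_abs_green_half_1d_mul_sub_log_le {t : ℝ} (ht : 0 < t) :
    ∀ᶠ x : ℝ in nhdsWithin 0 (Set.Ioi 0),
      |((√t / π) * ∫ τ in Set.Ioi (0 : ℝ),
          exp (-x ^ 2 / (4 * τ)) / (√τ * (t + τ) * √(4 * π * τ))) * 2 * π ^ (3 / 2 : ℝ) * √t -
        (log (4 * t) - log (x ^ 2))| ≤ 2 := by
  have hsmall : ∀ᶠ x : ℝ in nhdsWithin 0 (Set.Ioi 0), x ^ 2 / 4 < t := by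
    refine ((Continuous.tendsto' (by fun_prop) 0 0 (by norm_num)).mono_left
      nhdsWithin_le_nhds).eventually_lt_const ht
  filter_upwards [hsmall, self_mem_nhdsWithin] with x hx hx0
  have hx0 : 0 < x := hx0
  have hs : 0 < x ^ 2 / 4 := by positivity
  have hlog : log (4 * t) - log (x ^ 2) = log (t / (x ^ 2 / 4)) := by
    rw [← log_div (by positivity) (by positivity)]
    congr 1
    field_simp
  rw [green_half_1d_mul_eq ht, hlog]
  refine (abs_sub_le _ (log ((t + x ^ 2 / 4) / (x ^ 2 / 4))) _).trans ?_
  have h1 := abs_integral_exp_neg_div_sub_log_le hs ht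
  have h2 := abs_log_add_div_sub_log_le hs ht
  have h3 : x ^ 2 / 4 / t ≤ 1 := (div_le_one ht).2 hx.le
  linarith

theorem tendsto_div_one_of_eventually_abs_sub_le {α : Type*} {l : Filter α} {f g : α → ℝ} {C : ℝ}
    (hg : Tendsto g l atTop) (hfg : ∀ᶠ x in l, |f x - g x| ≤ C) :
    Tendsto (fun x => f x / g x) l (nhds 1) := by
  have hzero : Tendsto (fun x => (f x - g x) / g x) l (nhds 0) := by
    refine squeeze_zero_norm' ?_ (hg.const_div_atTop C)
    filter_upwards [hfg, hg.eventually_gt_atTop 0] with x hx hpos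
    rw [norm_eq_abs, abs_div, abs_of_pos hpos]
    gcongr
  have hone := hzero.add_const 1
  rw [zero_add] at hone
  refine hone.congr' ?_
  filter_upwards [hg.eventually_gt_atTop 0] with x hpos
  field_simp
  ring



/-- For fixed `t > 0`, the one-dimensional Green function
`G(x) = (√t/π) ∫_0^∞ e^{-x²/(4τ)} / (√τ (t+τ) √(4πτ)) dτ` grows logarithmically at the
origin: `G(x) · 2π^{3/2}√t / (ln(4t) − ln(x²)) → 1` as `x → 0+`, and `G(x) → +∞`. -/
theorem green_half_1d_asymp_zero (t : ℝ) (ht : 0 < t) :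
    Filter.Tendsto
      (fun x : ℝ =>
        ((Real.sqrt t / Real.pi) *
          ∫ τ in Set.Ioi (0 : ℝ),
            Real.exp (-x ^ 2 / (4 * τ)) /
              (Real.sqrt τ * (t + τ) * Real.sqrt (4 * Real.pi * τ))) *
          2 * Real.pi ^ (3 / 2 : ℝ) * Real.sqrt t / (Real.log (4 * t) - Real.log (x ^ 2)))
      (nhdsWithin 0 (Set.Ioi 0)) (nhds 1) ∧
    Filter.Tendsto
      (fun x : ℝ =>
        (Real.sqrt t / Real.pi) *
          ∫ τ in Set.Ioi (0 : ℝ),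
            Real.exp (-x ^ 2 / (4 * τ)) /
              (Real.sqrt τ * (t + τ) * Real.sqrt (4 * Real.pi * τ)))
      (nhdsWithin 0 (Set.Ioi 0)) Filter.atTop := by
  have hlog := tendsto_log_four_mul_sub_log_sq t
  have hbound := eventually_abs_green_half_1d_mul_sub_log_le ht
  refine ⟨tendsto_div_one_of_eventually_abs_sub_le hlog hbound, ?_⟩
  have hc : 0 < 2 * π ^ (3 / 2 : ℝ) * √t := by positivity
  rw [← tendsto_mul_const_atTop_of_pos hc]
  refine tendsto_atTop_mono' _ ?_ (tendsto_atTop_add_const_right _ (-2) hlog)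
  filter_upwards [hbound] with x hx
  simp only [← mul_assoc] at hx ⊢
  linarith [(abs_le.1 hx).1]
end

section
/- For every x ∈ ℝ with x ≠ 0 and every t > 0, the one-dimensional Green function with α = β = 1/2 is bracketed by elementary functions: (1 / (4 π^{3/2} √t)) · ln(1 + 8t/x²) < (√t / π) ∫_0^∞ e^{-x²/(4τ)} / (√τ (t + τ) √(4πτ)) dτ < (1 / (2 π^{3/2} √t)) · ln(1 + 4t/x²). -/
open Real MeasureTheory

lemma setIntegral_lt_setIntegral_of_forall_lt {α : Type*} [MeasurableSpace α] {μ : Measure α}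
    {s : Set α} {f g : α → ℝ} (hs : MeasurableSet s) (hμ : μ s ≠ 0)
    (hf : IntegrableOn f s μ) (hg : IntegrableOn g s μ) (h : ∀ x ∈ s, f x < g x) :
    ∫ x in s, f x ∂μ < ∫ x in s, g x ∂μ := by
  rw [← sub_pos, ← integral_sub' hg hf, setIntegral_pos_iff_support_of_nonneg_ae _ (hg.sub hf)]
  · have hsupp : s ⊆ Function.support (g - f) := fun x hx ↦ (sub_pos.2 (h x hx)).ne'
    rw [Set.inter_eq_right.2 hsupp]
    exact pos_iff_ne_zero.2 hμ
  · filter_upwards [self_mem_ae_restrict hs] with x hx using (sub_pos.2 (h x hx)).le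

lemma log_lt_half_sub_inv {v : ℝ} (hv : 1 < v) : log v < (v - v⁻¹) / 2 := by
  rw [← sinh_log (by positivity)]
  exact self_lt_sinh_iff.2 (log_pos hv)

lemma hasDerivAt_neg_exp_neg_mul_log {k z s : ℝ} (hk : 0 < k) (hs : 0 < s + z) :
    HasDerivAt (fun s ↦ -(exp (-s) * (log (1 + k / (s + z)) / k)))
      (exp (-s) * (log (1 + k / (s + z)) / k + 1 / ((s + z) * (s + z + k)))) s := by
  have hne : s + z ≠ 0 := hs.ne'
  have hpos : 1 + k / (s + z) ≠ 0 := by positivity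
  have hne' : s + z + k ≠ 0 := by positivity
  have h1 : HasDerivAt (fun s ↦ 1 + k / (s + z)) (-k / (s + z) ^ 2) s := by
    have := ((hasDerivAt_const s k).div ((hasDerivAt_id s).add_const z) hne).const_add 1
    simpa using this
  refine ((hasDerivAt_neg s).exp.mul ((h1.log hpos).div_const k)).neg.congr_deriv ?_
  field_simp
  ring

lemma tendsto_neg_exp_neg_mul_log (k z : ℝ) :
    Filter.Tendsto (fun s ↦ -(exp (-s) * (log (1 + k / (s + z)) / k))) Filter.atTop (nhds 0) := by
  have h1 : Filter.Tendsto (fun s : ℝ ↦ k / (s + z)) Filter.atTop (nhds 0) :=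
    (Filter.tendsto_atTop_add_const_right _ z Filter.tendsto_id).const_div_atTop k
  have h2 : Filter.Tendsto (fun s : ℝ ↦ log (1 + k / (s + z))) Filter.atTop (nhds 0) := by
    simpa using (h1.const_add 1).log (by simp)
  simpa using (tendsto_exp_neg_atTop_nhds_zero.mul (h2.div_const k)).neg

lemma exp_neg_mul_log_deriv_nonneg {k z : ℝ} (hk : 0 < k) (hz : 0 < z) :
    ∀ s ∈ Set.Ioi (0 : ℝ),
      0 ≤ exp (-s) * (log (1 + k / (s + z)) / k + 1 / ((s + z) * (s + z + k))) := by
  intro s hs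
  have hs : 0 < s := hs
  have : 0 ≤ log (1 + k / (s + z)) := log_nonneg (le_add_of_nonneg_right (by positivity))
  positivity

lemma integrableOn_exp_neg_mul_log_deriv {k z : ℝ} (hk : 0 < k) (hz : 0 < z) :
    IntegrableOn (fun s ↦ exp (-s) * (log (1 + k / (s + z)) / k + 1 / ((s + z) * (s + z + k))))
      (Set.Ioi 0) :=
  integrableOn_Ioi_deriv_of_nonneg'
    (fun _ hs ↦ hasDerivAt_neg_exp_neg_mul_log hk (add_pos_of_nonneg_of_pos hs hz))
    (exp_neg_mul_log_deriv_nonneg hk hz) (tendsto_neg_exp_neg_mul_log k z)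

lemma integral_exp_neg_mul_log_deriv {k z : ℝ} (hk : 0 < k) (hz : 0 < z) :
    ∫ s in Set.Ioi 0, exp (-s) * (log (1 + k / (s + z)) / k + 1 / ((s + z) * (s + z + k))) =
      log (1 + k / z) / k := by
  rw [integral_Ioi_of_hasDerivAt_of_nonneg'
    (fun _ hs ↦ hasDerivAt_neg_exp_neg_mul_log hk (add_pos_of_nonneg_of_pos hs hz))
    (exp_neg_mul_log_deriv_nonneg hk hz) (tendsto_neg_exp_neg_mul_log k z)]
  simp

lemma integrableOn_exp_neg_div_add {z : ℝ} (hz : 0 < z) :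
    IntegrableOn (fun s ↦ exp (-s) / (s + z)) (Set.Ioi 0) := by
  refine ((integrableOn_exp_neg_Ioi 0).div_const z).mono'
    (by fun_prop : Measurable _).aestronglyMeasurable ?_
  filter_upwards [self_mem_ae_restrict measurableSet_Ioi] with s hs
  have hs : 0 < s := hs
  rw [norm_of_nonneg (by positivity)]
  gcongr
  linarith

/-- Upper bound for `exp z * E₁ z`, where `E₁` is the exponential integral. -/
lemma integral_exp_neg_div_add_lt {z : ℝ} (hz : 0 < z) :
    ∫ s in Set.Ioi 0, exp (-s) / (s + z) < log (1 + 1 / z) := by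
  rw [← div_one (log _), ← integral_exp_neg_mul_log_deriv one_pos hz]
  refine setIntegral_lt_setIntegral_of_forall_lt measurableSet_Ioi (by simp)
    (integrableOn_exp_neg_div_add hz) (integrableOn_exp_neg_mul_log_deriv one_pos hz) ?_
  intro s hs
  have hu : 0 < s + z := add_pos hs hz
  generalize s + z = u at hu ⊢
  rw [div_eq_mul_one_div]
  gcongr
  have h := lt_log_one_add_of_pos (one_div_pos.2 hu)
  have h2 : 1 / u - 1 / (u * (u + 1)) ≤ 2 * (1 / u) / (1 / u + 2) := by
    field_simp
    nlinarith
  linarith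

/-- Lower bound for `exp z * E₁ z`, where `E₁` is the exponential integral. -/
lemma lt_integral_exp_neg_div_add {z : ℝ} (hz : 0 < z) :
    log (1 + 2 / z) / 2 < ∫ s in Set.Ioi 0, exp (-s) / (s + z) := by
  rw [← integral_exp_neg_mul_log_deriv two_pos hz]
  refine setIntegral_lt_setIntegral_of_forall_lt measurableSet_Ioi (by simp)
    (integrableOn_exp_neg_mul_log_deriv two_pos hz) (integrableOn_exp_neg_div_add hz) ?_
  intro s hs
  have hu : 0 < s + z := add_pos hs hz
  generalize s + z = u at hu ⊢
  rw [div_eq_mul_one_div (exp (-s))]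
  gcongr
  have h := log_lt_half_sub_inv (lt_add_of_pos_right 1 (div_pos two_pos hu))
  have h2 : (1 + 2 / u - (1 + 2 / u)⁻¹) / 2 / 2 + 1 / (u * (u + 2)) = 1 / u := by
    field_simp
    ring
  linarith

lemma integral_green_half_eq {x t : ℝ} (hx : x ≠ 0) (ht : 0 < t) :
    ∫ τ in Set.Ioi (0 : ℝ), exp (-x ^ 2 / (4 * τ)) / (√τ * (t + τ) * √(4 * π * τ)) =
      1 / (2 * √π * t) * ∫ s in Set.Ioi 0, exp (-s) / (s + x ^ 2 / (4 * t)) := by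
  have ha : 0 < x ^ 2 / 4 := by positivity
  have hscale := integral_comp_mul_left_Ioi (fun s ↦ exp (-s) / (s + x ^ 2 / (4 * t))) 0 ha
  rw [mul_zero, smul_eq_mul, eq_inv_mul_iff_mul_eq₀ ha.ne'] at hscale
  have hinv := integral_comp_rpow_Ioi
    (fun s ↦ exp (-(x ^ 2 / 4 * s)) / (x ^ 2 / 4 * s + x ^ 2 / (4 * t)))
    (neg_ne_zero.2 one_ne_zero)
  rw [← hscale, ← hinv, ← integral_const_mul, ← integral_const_mul]
  refine setIntegral_congr_fun measurableSet_Ioi fun τ hτ ↦ ?_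
  have hτ : 0 < τ := hτ
  have hsqrt : √τ * (t + τ) * √(4 * π * τ) = 2 * √π * τ * (t + τ) := by
    rw [sqrt_mul (by positivity), sqrt_mul (by norm_num), show (4 : ℝ) = 2 ^ 2 by norm_num,
      sqrt_sq two_pos.le]
    linear_combination 2 * √π * (t + τ) * mul_self_sqrt hτ.le
  have hpow : τ ^ (-1 - 1 : ℝ) = (τ ^ 2)⁻¹ := by
    rw [show (-1 - 1 : ℝ) = -(2 : ℕ) by norm_num, rpow_neg hτ.le, rpow_natCast]
  have hexp : -(x ^ 2 / 4 * τ⁻¹) = -x ^ 2 / (4 * τ) := by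
    field_simp
  simp only [smul_eq_mul, abs_neg, abs_one, one_mul, hpow, rpow_neg_one, hsqrt, hexp]
  field_simp

/-- For every real `x ≠ 0` and `t > 0`, the one-dimensional Green function with
`α = β = 1/2` is bracketed by elementary logarithmic functions. -/
theorem green_half_1d_bracket (x t : ℝ) (hx : x ≠ 0) (ht : 0 < t) :
    (1 / (4 * Real.pi ^ (3 / 2 : ℝ) * Real.sqrt t)) * Real.log (1 + 8 * t / x ^ 2) <
      (Real.sqrt t / Real.pi) *
        ∫ τ in Set.Ioi (0 : ℝ),
          Real.exp (-x ^ 2 / (4 * τ)) /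
            (Real.sqrt τ * (t + τ) * Real.sqrt (4 * Real.pi * τ)) ∧
    (Real.sqrt t / Real.pi) *
        ∫ τ in Set.Ioi (0 : ℝ),
          Real.exp (-x ^ 2 / (4 * τ)) /
            (Real.sqrt τ * (t + τ) * Real.sqrt (4 * Real.pi * τ)) <
      (1 / (2 * Real.pi ^ (3 / 2 : ℝ) * Real.sqrt t)) * Real.log (1 + 4 * t / x ^ 2) := by
  have hz : 0 < x ^ 2 / (4 * t) := by positivity
  have hlower := lt_integral_exp_neg_div_add hz
  have hupper := integral_exp_neg_div_add_lt hz
  have hpi : π ^ (3 / 2 : ℝ) = π * √π := by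
    rw [show (3 / 2 : ℝ) = 1 + 1 / 2 by norm_num, rpow_add pi_pos, rpow_one, sqrt_eq_rpow]
  have hc : 0 < 1 / (2 * π ^ (3 / 2 : ℝ) * √t) := by positivity
  have hcoef : √t / π * (1 / (2 * √π * t)) = 1 / (2 * π ^ (3 / 2 : ℝ) * √t) := by
    rw [hpi]
    field_simp
    exact sq_sqrt ht.le
  rw [show 2 / (x ^ 2 / (4 * t)) = 8 * t / x ^ 2 by field_simp; norm_num] at hlower
  rw [one_div_div] at hupper
  rw [integral_green_half_eq hx ht, ← mul_assoc, hcoef]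
  refine ⟨?_, mul_lt_mul_of_pos_left hupper hc⟩
  calc
    _ = 1 / (2 * π ^ (3 / 2 : ℝ) * √t) * (log (1 + 8 * t / x ^ 2) / 2) := by ring
    _ < _ := mul_lt_mul_of_pos_left hlower hc
end

section
/- Let 0 < α < 1, x > 0, and t > 0. Then the fundamental solution of the one-dimensional space-time fractional (neutral) diffusion equation satisfies (1/π²) ∫_0^∞ (t^α τ^{α-1} sin(απ)) / (t^{2α} + 2 t^α τ^α cos(απ) + τ^{2α}) · (τ / (τ² + x²)) dτ = (1/π) · (t^α x^{α-1} sin(απ/2)) / (t^{2α} + 2 t^α x^α cos(απ/2) + x^{2α}). -/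
open Real MeasureTheory

/-- Under the Cayley transform, the circle average over the unit circle becomes the average over
the real line with respect to the Cauchy distribution. -/
theorem circleAverage_eq_integral_cayley {E : Type*} [NormedAddCommGroup E] [NormedSpace ℝ E]
    (f : ℂ → E) :
    circleAverage f 0 1 =
      π⁻¹ • ∫ y : ℝ, (1 + y ^ 2)⁻¹ •
        f ((1 - y * Complex.I) / (1 + y * Complex.I)) := by
  have himage : (fun y : ℝ ↦ -2 * arctan y) '' Set.univ = Set.Ioo (-π) π := by
    ext θ
    constructor
    · rintro ⟨y, -, rfl⟩
      have h := arctan_mem_Ioo y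
      constructor <;> dsimp only <;> linarith [h.1, h.2]
    · rintro ⟨h₁, h₂⟩
      refine ⟨tan (-θ / 2), trivial, ?_⟩
      dsimp only
      rw [arctan_tan (by linarith) (by linarith)]
      ring
  have hchange := integral_image_eq_integral_abs_deriv_smul (s := Set.univ)
    (f := fun y : ℝ ↦ -2 * arctan y) (f' := fun y ↦ -2 * (1 + y ^ 2)⁻¹) MeasurableSet.univ
    (fun y _ ↦ ((hasDerivAt_arctan' y).const_mul (-2)).hasDerivWithinAt)
    (fun a _ b _ h ↦ arctan_injective (by simpa using h)) (fun θ ↦ f (circleMap 0 1 θ))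
  have hcircle (y : ℝ) : circleMap 0 1 (-2 * arctan y) =
      (1 - y * Complex.I) / (1 + y * Complex.I) := by
    have hy : (1 + y * Complex.I : ℂ) ≠ 0 := fun h ↦ by simpa using congrArg Complex.re h
    have hs : (1 + y ^ 2 : ℝ) ≠ 0 := by positivity
    have hcos : cos (-2 * arctan y) = (1 - y ^ 2) / (1 + y ^ 2) := by
      rw [neg_mul, cos_neg, cos_two_mul, cos_sq_arctan]
      field_simp
      ring
    have hsin : sin (-2 * arctan y) = -2 * y / (1 + y ^ 2) := by
      rw [neg_mul, sin_neg, sin_two_mul, sin_arctan, cos_arctan]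
      field_simp
      rw [sq_sqrt (by positivity)]
    rw [circleMap_zero, Complex.ofReal_one, one_mul, Complex.exp_mul_I, ← Complex.ofReal_cos,
      ← Complex.ofReal_sin, hcos, hsin, eq_div_iff hy]
    apply Complex.ext
    · simp only [Complex.mul_re, Complex.mul_im, Complex.add_re, Complex.add_im, Complex.sub_re,
        Complex.one_re, Complex.one_im, Complex.I_re, Complex.I_im, Complex.ofReal_re,
        Complex.ofReal_im]
      field_simp
      ring
    · simp only [Complex.mul_re, Complex.mul_im, Complex.add_re, Complex.add_im, Complex.sub_im,
        Complex.one_re, Complex.one_im, Complex.I_re, Complex.I_im, Complex.ofReal_re,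
        Complex.ofReal_im]
      field_simp
      ring
  have hper : (fun θ ↦ f (circleMap 0 1 θ)).Periodic (2 * π) :=
    fun θ ↦ by simp [periodic_circleMap 0 1 θ]
  have hshift := hper.intervalIntegral_add_eq 0 (-π)
  rw [zero_add, show -π + 2 * π = π by ring,
    intervalIntegral.integral_of_le (a := -π) (by linarith [pi_pos]),
    integral_Ioc_eq_integral_Ioo, ← himage, hchange, setIntegral_univ] at hshift
  rw [circleAverage_def, hshift, mul_inv, mul_comm, mul_smul, ← integral_smul]
  congr 2 with y
  rw [hcircle, smul_smul, abs_mul, abs_of_pos (show (0 : ℝ) < (1 + y ^ 2)⁻¹ by positivity)]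
  norm_num [← mul_assoc]

theorem Complex.mul_cpow_of_re {w a : ℂ} (hw : 0 ≤ w.re) (ha : 0 < a.re) {s : ℂ} (hs : s ≠ 0) :
    (w * a) ^ s = w ^ s * a ^ s := by
  have ha' : a ≠ 0 := by rintro rfl; simp at ha
  rcases eq_or_ne w 0 with rfl | hw'
  · simp [hs]
  have h₁ := abs_le.1 (abs_arg_le_pi_div_two_iff.2 hw)
  have h₂ := abs_lt.1 (abs_arg_lt_pi_div_two_iff.2 (Or.inl ha))
  rw [cpow_def_of_ne_zero (mul_ne_zero hw' ha'), cpow_def_of_ne_zero hw', cpow_def_of_ne_zero ha',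
    log_mul_eq_add_log_iff hw' ha' |>.2 ⟨by linarith [h₁.1, h₂.1], by linarith [h₁.2, h₂.2]⟩,
    add_mul, exp_add]

theorem Complex.inv_add_polar_im (T Z γ : ℝ) :
    ((T + Z * (Real.cos γ + Real.sin γ * I) : ℂ)⁻¹).im =
      -(Z * Real.sin γ) / (T ^ 2 + 2 * T * Z * Real.cos γ + Z ^ 2) := by
  rw [inv_im, normSq_apply]
  simp only [add_re, add_im, mul_re, mul_im, ofReal_re, ofReal_im, I_re, I_im]
  congr 1
  · ring
  · linear_combination Z ^ 2 * Real.sin_sq_add_cos_sq γ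

section

variable {α T X : ℝ}

theorem add_polar_mul_cpow_ne_zero (hα0 : 0 < α) (hα1 : α < 1) (hT : 0 < T) (hX : 0 < X) {w : ℂ}
    (hw : 0 ≤ w.re) :
    (T + X * (cos (α * π / 2) + sin (α * π / 2) * Complex.I) * w ^ (α : ℂ) : ℂ) ≠ 0 := by
  intro h
  have hβ : 0 < cos (α * π / 2) :=
    cos_pos_of_mem_Ioo ⟨by nlinarith [pi_pos], by nlinarith [pi_pos]⟩
  have harg := abs_le.1 (Complex.abs_arg_le_pi_div_two_iff.2 hw)
  have hcos : 0 ≤ cos (w.arg * α) :=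
    cos_nonneg_of_neg_pi_div_two_le_of_le (by nlinarith [pi_pos]) (by nlinarith [pi_pos])
  have hre : 0 ≤ (w ^ (α : ℂ)).re := by
    rw [Complex.cpow_ofReal_re]
    positivity
  set v := w ^ (α : ℂ)
  have h₁ := congrArg Complex.re h
  have h₂ := congrArg Complex.im h
  simp only [Complex.mul_re, Complex.mul_im, Complex.add_re, Complex.add_im, Complex.I_re,
    Complex.I_im, Complex.ofReal_re, Complex.ofReal_im, Complex.zero_re, Complex.zero_im] at h₁ h₂
  have : T * cos (α * π / 2) + X * v.re = 0 := by
    linear_combination cos (α * π / 2) * h₁ + sin (α * π / 2) * h₂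
      - X * v.re * sin_sq_add_cos_sq (α * π / 2)
  nlinarith [mul_pos hT hβ, mul_nonneg hX.le hre]

/-- The function `z ↦ (T + X (-i z) ^ α)⁻¹` on the upper half-plane, transported to the unit disc,
in a form that is continuous up to the boundary. -/
noncomputable def discResolvent (α T X : ℝ) (ζ : ℂ) : ℂ :=
  (1 + ζ) ^ (α : ℂ) / (T * (1 + ζ) ^ (α : ℂ) +
    X * (cos (α * π / 2) + sin (α * π / 2) * Complex.I) * (1 - ζ) ^ (α : ℂ))

theorem discResolvent_denom_ne_zero (hα0 : 0 < α) (hα1 : α < 1) (hT : 0 < T) (hX : 0 < X) {ζ : ℂ}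
    (hζ : ‖ζ‖ ≤ 1) :
    (T * (1 + ζ) ^ (α : ℂ) +
      X * (cos (α * π / 2) + sin (α * π / 2) * Complex.I) * (1 - ζ) ^ (α : ℂ) : ℂ) ≠ 0 := by
  have hα : (α : ℂ) ≠ 0 := by exact_mod_cast hα0.ne'
  have hsq : ζ.re ^ 2 + ζ.im ^ 2 ≤ 1 := by
    have := Complex.sq_norm ζ
    rw [Complex.normSq_apply] at this
    nlinarith [norm_nonneg ζ]
  rcases eq_or_ne ζ (-1) with rfl | hne
  · have h := add_polar_mul_cpow_ne_zero hα0 hα1 hT hX (w := 0) le_rfl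
    have hpolar : (cos (α * π / 2) + sin (α * π / 2) * Complex.I : ℂ) ≠ 0 := by
      rw [Complex.ofReal_cos, Complex.ofReal_sin, ← Complex.exp_mul_I]
      exact Complex.exp_ne_zero _
    have hX' : (X : ℂ) ≠ 0 := by exact_mod_cast hX.ne'
    rw [add_neg_cancel, Complex.zero_cpow hα, mul_zero, zero_add]
    exact mul_ne_zero (mul_ne_zero hX' hpolar) (by simp [Complex.cpow_eq_zero_iff])
  · have hre : 0 < (1 + ζ).re := by
      have h₁ : -1 ≤ ζ.re := by nlinarith [sq_nonneg ζ.im]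
      rcases h₁.lt_or_eq with h | h
      · simp; linarith
      · exact absurd (Complex.ext (by simp [← h]) (by simp; nlinarith)) hne
    have hne' : 1 + ζ ≠ 0 := fun h ↦ by simp [h] at hre
    have hw : 0 ≤ ((1 - ζ) / (1 + ζ)).re := by
      rw [Complex.div_re, ← add_div]
      refine div_nonneg ?_ (Complex.normSq_nonneg _)
      simp
      nlinarith
    have hmul := Complex.mul_cpow_of_re hw hre hα
    rw [div_mul_cancel₀ _ hne'] at hmul
    rw [hmul]
    have h := mul_ne_zero (add_polar_mul_cpow_ne_zero hα0 hα1 hT hX hw)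
      (show (1 + ζ) ^ (α : ℂ) ≠ 0 by simp [Complex.cpow_eq_zero_iff, hne'])
    convert h using 1
    ring

theorem diffContOnCl_discResolvent (hα0 : 0 < α) (hα1 : α < 1) (hT : 0 < T) (hX : 0 < X) :
    DiffContOnCl ℂ (discResolvent α T X) (Metric.ball 0 1) := by
  constructor
  · intro ζ hζ
    have hζ' : ‖ζ‖ < 1 := by simpa using hζ
    have hre := abs_lt.1 ((Complex.abs_re_le_norm ζ).trans_lt hζ')
    have h₁ : 1 + ζ ∈ Complex.slitPlane := Or.inl (by simp; linarith [hre.1])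
    have h₂ : 1 - ζ ∈ Complex.slitPlane := Or.inl (by simp; linarith [hre.2])
    have d₁ : DifferentiableAt ℂ (fun ζ : ℂ ↦ (1 + ζ) ^ (α : ℂ)) ζ :=
      DifferentiableAt.cpow (by fun_prop) (by fun_prop) h₁
    have d₂ : DifferentiableAt ℂ (fun ζ : ℂ ↦ (1 - ζ) ^ (α : ℂ)) ζ :=
      DifferentiableAt.cpow (by fun_prop) (by fun_prop) h₂
    exact (d₁.div ((d₁.const_mul _).add (d₂.const_mul _))
      (discResolvent_denom_ne_zero hα0 hα1 hT hX hζ'.le)).differentiableWithinAt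
  · rw [closure_ball _ one_ne_zero]
    intro ζ hζ
    have hζ' : ‖ζ‖ ≤ 1 := by simpa using hζ
    have hre := abs_le.1 ((Complex.abs_re_le_norm ζ).trans hζ')
    have c₁ : ContinuousAt (fun ζ : ℂ ↦ (1 + ζ) ^ (α : ℂ)) ζ :=
      ContinuousAt.comp (g := fun z : ℂ ↦ z ^ (α : ℂ)) (Complex.continuousAt_cpow_const_of_re_pos
        (Or.inl (by simp; linarith [hre.1])) (by simpa)) (by fun_prop)
    have c₂ : ContinuousAt (fun ζ : ℂ ↦ (1 - ζ) ^ (α : ℂ)) ζ :=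
      ContinuousAt.comp (g := fun z : ℂ ↦ z ^ (α : ℂ)) (Complex.continuousAt_cpow_const_of_re_pos
        (Or.inl (by simp; linarith [hre.2])) (by simpa)) (by fun_prop)
    exact (c₁.div ((c₁.const_mul _).add (c₂.const_mul _))
      (discResolvent_denom_ne_zero hα0 hα1 hT hX hζ')).continuousWithinAt

theorem discResolvent_cayley (hα0 : 0 < α) (y : ℝ) :
    discResolvent α T X ((1 - y * Complex.I) / (1 + y * Complex.I)) =
      (T + X * (cos (α * π / 2) + sin (α * π / 2) * Complex.I) *
        (y * Complex.I) ^ (α : ℂ) : ℂ)⁻¹ := by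
  have hα : (α : ℂ) ≠ 0 := by exact_mod_cast hα0.ne'
  have hy : (1 + y * Complex.I : ℂ) ≠ 0 := fun h ↦ by simpa using congrArg Complex.re h
  have h₁ : 1 + (1 - y * Complex.I) / (1 + y * Complex.I) = 2 / (1 + y * Complex.I) := by
    field_simp
    ring
  have h₂ : 1 - (1 - y * Complex.I) / (1 + y * Complex.I) =
      y * Complex.I * (2 / (1 + y * Complex.I)) := by
    field_simp
    ring
  have hre : 0 < (2 / (1 + y * Complex.I)).re := by
    rw [Complex.div_re]
    have := Complex.normSq_pos.2 hy
    simp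
    positivity
  have hne : (2 / (1 + y * Complex.I)) ^ (α : ℂ) ≠ 0 := by simp [Complex.cpow_eq_zero_iff, hy]
  rw [discResolvent, h₁, h₂, Complex.mul_cpow_of_re (by simp) hre hα, ← mul_assoc, ← add_mul,
    div_mul_cancel_right₀ hne]

theorem discResolvent_cayley_im_of_pos (hα0 : 0 < α) {y : ℝ} (hy : 0 < y) :
    (discResolvent α T X ((1 - y * Complex.I) / (1 + y * Complex.I))).im =
      -(X * y ^ α * sin (α * π)) /
        (T ^ 2 + 2 * T * (X * y ^ α) * cos (α * π) + (X * y ^ α) ^ 2) := by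
  rw [discResolvent_cayley hα0, ← Complex.inv_add_polar_im, Complex.cpow_ofReal,
    Complex.arg_real_mul _ hy, Complex.arg_I]
  have h : α * π = α * π / 2 + α * π / 2 := by ring
  rw [h, cos_add, sin_add, ← h, show π / 2 * α = α * π / 2 by ring]
  congr 2
  simp only [norm_mul, Complex.norm_real, norm_eq_abs, abs_of_pos hy, Complex.norm_I, mul_one]
  push_cast
  linear_combination (X * (y ^ α : ℝ) * Complex.sin (α * π / 2) ^ 2 : ℂ) * Complex.I_sq

theorem discResolvent_cayley_im_of_nonpos (hα0 : 0 < α) {y : ℝ} (hy : y ≤ 0) :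
    (discResolvent α T X ((1 - y * Complex.I) / (1 + y * Complex.I))).im = 0 := by
  have hα : (α : ℂ) ≠ 0 := by exact_mod_cast hα0.ne'
  rw [discResolvent_cayley hα0]
  rcases hy.eq_or_lt with rfl | hy
  · rw [Complex.ofReal_zero, zero_mul, Complex.zero_cpow hα, mul_zero, add_zero,
      ← Complex.ofReal_inv, Complex.ofReal_im]
  · have h : (y * Complex.I : ℂ) = ((-y : ℝ) : ℂ) * -Complex.I := by push_cast; ring
    rw [h, Complex.cpow_ofReal, Complex.arg_real_mul _ (neg_pos.2 hy), Complex.arg_neg_I,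
      show -(π / 2) * α = -(α * π / 2) by ring, cos_neg, sin_neg]
    generalize ‖((-y : ℝ) : ℂ) * -Complex.I‖ ^ α = r
    have hreal : (T + X * (cos (α * π / 2) + sin (α * π / 2) * Complex.I) *
        (r * (cos (α * π / 2) + (-sin (α * π / 2) : ℝ) * Complex.I)) : ℂ) =
        ((T + X * r : ℝ) : ℂ) := by
      push_cast
      linear_combination (X * r : ℂ) * Complex.sin_sq_add_cos_sq (α * π / 2)
        - (X * r * Complex.sin (α * π / 2) ^ 2 : ℂ) * Complex.I_sq
    rw [hreal, ← Complex.ofReal_inv, Complex.ofReal_im]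

theorem discResolvent_zero_im :
    (discResolvent α T X 0).im =
      -(X * sin (α * π / 2)) / (T ^ 2 + 2 * T * X * cos (α * π / 2) + X ^ 2) := by
  simp only [discResolvent, add_zero, sub_zero, Complex.one_cpow, mul_one, one_div,
    Complex.inv_add_polar_im]

theorem integral_rpow_mul_sin_div_mul_inv_one_add_sq (hα0 : 0 < α) (hα1 : α < 1) (hT : 0 < T)
    (hX : 0 < X) :
    ∫ y in Set.Ioi (0 : ℝ), (1 + y ^ 2)⁻¹ * (X * y ^ α * sin (α * π) /
        (T ^ 2 + 2 * T * (X * y ^ α) * cos (α * π) + (X * y ^ α) ^ 2)) =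
      π * (X * sin (α * π / 2) / (T ^ 2 + 2 * T * X * cos (α * π / 2) + X ^ 2)) := by
  have hd := diffContOnCl_discResolvent hα0 hα1 hT hX
  have hci : CircleIntegrable (discResolvent α T X) 0 1 := by
    refine ContinuousOn.circleIntegrable zero_le_one (hd.continuousOn.mono ?_)
    rw [closure_ball _ one_ne_zero]
    exact Metric.sphere_subset_closedBall
  have hmean := Complex.imCLM.circleAverage_comp_comm hci
  rw [DiffContOnCl.circleAverage (by simpa using hd), Complex.imCLM_apply, discResolvent_zero_im,
    circleAverage_eq_integral_cayley,
    ← setIntegral_eq_integral_of_forall_compl_eq_zero (s := Set.Ioi 0) (fun y hy ↦ by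
      simp only [Function.comp_apply, Complex.imCLM_apply]
      rw [discResolvent_cayley_im_of_nonpos hα0 (not_lt.1 hy), smul_zero])] at hmean
  rw [setIntegral_congr_fun measurableSet_Ioi
    (g := fun y ↦ -((1 + y ^ 2)⁻¹ * (X * y ^ α * sin (α * π) /
        (T ^ 2 + 2 * T * (X * y ^ α) * cos (α * π) + (X * y ^ α) ^ 2)))) (fun y hy ↦ by
      simp only [Function.comp_apply, Complex.imCLM_apply]
      rw [discResolvent_cayley_im_of_pos hα0 hy, smul_eq_mul, neg_div, mul_neg]),
    integral_neg, smul_eq_mul, neg_div, mul_neg, neg_inj, inv_mul_eq_iff_eq_mul₀ pi_ne_zero]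
    at hmean
  exact hmean

end

/-- For `0 < α < 1`, `x > 0`, `t > 0`, the fundamental solution of the one-dimensional
space-time fractional (neutral) diffusion equation obtained by subordination of the
Poisson kernel has the stated closed form. -/
theorem neutral_diffusion_1d (α x t : ℝ) (hα0 : 0 < α) (hα1 : α < 1)
    (hx : 0 < x) (ht : 0 < t) :
    (1 / Real.pi ^ 2) *
      ∫ τ in Set.Ioi (0 : ℝ),
        (t ^ α * τ ^ (α - 1) * Real.sin (α * Real.pi)) /
          (t ^ (2 * α) + 2 * t ^ α * τ ^ α * Real.cos (α * Real.pi) + τ ^ (2 * α)) *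
          (τ / (τ ^ 2 + x ^ 2))
      = (1 / Real.pi) * (t ^ α * x ^ (α - 1) * Real.sin (α * Real.pi / 2)) /
          (t ^ (2 * α) + 2 * t ^ α * x ^ α * Real.cos (α * Real.pi / 2) + x ^ (2 * α)) := by
  have hsq {a : ℝ} (ha : 0 < a) : a ^ (2 * α) = (a ^ α) ^ 2 := by
    rw [mul_comm, rpow_mul ha.le, rpow_two]
  have hscale := integral_comp_mul_left_Ioi' (fun τ ↦
    (t ^ α * τ ^ (α - 1) * Real.sin (α * Real.pi)) /
      (t ^ (2 * α) + 2 * t ^ α * τ ^ α * Real.cos (α * Real.pi) + τ ^ (2 * α)) *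
      (τ / (τ ^ 2 + x ^ 2))) 0 hx
  rw [mul_zero] at hscale
  rw [← hscale, setIntegral_congr_fun measurableSet_Ioi
    (g := fun y ↦ t ^ α / x ^ 2 * ((1 + y ^ 2)⁻¹ * (x ^ α * y ^ α * sin (α * π) /
        ((t ^ α) ^ 2 + 2 * t ^ α * (x ^ α * y ^ α) * cos (α * π) + (x ^ α * y ^ α) ^ 2))))
    (fun y (hy : 0 < y) ↦ by
      have hxy := mul_pos hx hy
      dsimp only
      rw [hsq ht, hsq hxy, rpow_sub_one hxy.ne', mul_rpow hx.le hy.le]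
      generalize (t ^ α) ^ 2 + 2 * t ^ α * (x ^ α * y ^ α) * cos (α * π) + (x ^ α * y ^ α) ^ 2 = D
      rw [show (x * y) ^ 2 + x ^ 2 = x ^ 2 * (1 + y ^ 2) by ring]
      field_simp),
    integral_const_mul, integral_rpow_mul_sin_div_mul_inv_one_add_sq hα0 hα1 (rpow_pos_of_pos ht α)
      (rpow_pos_of_pos hx α), hsq ht, hsq hx, rpow_sub_one hx.ne', smul_eq_mul]
  field_simp
end

section
/- Let 0 < α < 1, x > 0, and t > 0. Then the Mittag-Leffler sine transform identity holds: (t^α / (π x)) ∫_0^∞ σ^{α-1} E_{α,α}(-t^α σ^α) sin(xσ) dσ = (1/π) · (t^α x^{α-1} sin(απ/2)) / (t^{2α} + 2 t^α x^α cos(απ/2) + x^{2α}), where E_{α,α}(z) = ∑_{k=0}^∞ z^k / Γ(αk + α), and the integral converges (as an improper Riemann integral). -/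
open Real MeasureTheory Filter

open Set Topology in
lemma integral_rpow_mul_cexp_neg_mul_Ioi {b : ℝ} (hb : 0 < b) {s : ℂ} (hs : 0 < s.re) :
    ∫ σ in Ioi (0 : ℝ), ((σ ^ (b - 1) : ℝ) : ℂ) * Complex.exp (-(s * σ))
      = s ^ (-(b : ℂ)) * Real.Gamma b := by
  set μ : Measure ℝ := (volume.restrict (Ioi 0)).withDensity
    (fun σ => ENNReal.ofReal (σ ^ (b - 1))) with hμ
  have hmeas : Measurable fun σ : ℝ => ENNReal.ofReal (σ ^ (b - 1)) := by fun_prop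
  have hfin : ∀ᵐ σ ∂(volume.restrict (Ioi (0 : ℝ))), ENNReal.ofReal (σ ^ (b - 1)) < ⊤ :=
    ae_of_all _ fun _ => ENNReal.ofReal_lt_top
  have hmgf (z : ℂ) : ProbabilityTheory.complexMGF id μ (-z)
      = ∫ σ in Ioi (0 : ℝ), ((σ ^ (b - 1) : ℝ) : ℂ) * Complex.exp (-(z * σ)) := by
    rw [ProbabilityTheory.complexMGF, hμ,
      integral_withDensity_eq_integral_toReal_smul hmeas hfin]
    refine setIntegral_congr_fun measurableSet_Ioi fun σ hσ => ?_
    simp [ENNReal.toReal_ofReal (rpow_nonneg (le_of_lt hσ) _)]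
  have hset : Iio (0 : ℝ) ⊆ ProbabilityTheory.integrableExpSet id μ := by
    intro t ht
    rw [ProbabilityTheory.integrableExpSet, mem_ofPred_eq, hμ,
      integrable_withDensity_iff hmeas hfin]
    have := integrableOn_rpow_mul_exp_neg_mul_rpow (s := b - 1) (p := 1) (b := -t)
      (by linarith) one_pos (by simpa using ht)
    refine this.congr_fun (fun σ hσ => ?_) measurableSet_Ioi
    simp [ENNReal.toReal_ofReal (rpow_nonneg (le_of_lt hσ) _), mul_comm]
  have hU : IsPreconnected {z : ℂ | 0 < z.re} :=
    (convex_halfSpace_re_gt 0).isPreconnected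
  have hO : IsOpen {z : ℂ | 0 < z.re} := isOpen_lt continuous_const Complex.continuous_re
  have hf : AnalyticOnNhd ℂ (fun z => ProbabilityTheory.complexMGF id μ (-z)) {z | 0 < z.re} := by
    refine DifferentiableOn.analyticOnNhd (fun z hz => ?_) hO
    refine DifferentiableAt.differentiableWithinAt ?_
    have : (-z).re ∈ interior (ProbabilityTheory.integrableExpSet id μ) :=
      (isOpen_Iio.subset_interior_iff.mpr hset) (by simpa using hz)
    exact (ProbabilityTheory.hasDerivAt_complexMGF this).differentiableAt.comp z
      differentiableAt_id.neg
  have hg : AnalyticOnNhd ℂ (fun z : ℂ => z ^ (-(b : ℂ)) * Real.Gamma b) {z | 0 < z.re} := by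
    refine DifferentiableOn.analyticOnNhd (fun z hz => ?_) hO
    refine DifferentiableAt.differentiableWithinAt ?_
    exact (differentiableAt_id.cpow_const (Or.inl hz)).mul_const _
  have hreal (r : ℝ) (hr : 0 < r) :
      ProbabilityTheory.complexMGF id μ (-(r : ℂ)) = (r : ℂ) ^ (-(b : ℂ)) * Real.Gamma b := by
    have h := congrArg (fun y : ℝ => (y : ℂ)) (integral_rpow_mul_exp_neg_mul_Ioi hb hr)
    rw [hmgf]
    simp only [one_div, inv_rpow hr.le, ← rpow_neg hr.le] at h
    rw [← integral_complex_ofReal] at h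
    push_cast [Complex.ofReal_cpow hr.le] at h ⊢
    exact h
  have hfreq : ∃ᶠ z in 𝓝[≠] (1 : ℂ), ProbabilityTheory.complexMGF id μ (-z)
      = z ^ (-(b : ℂ)) * Real.Gamma b := by
    have ht : Tendsto (fun r : ℝ => (r : ℂ)) (𝓝[>] 1) (𝓝[≠] (1 : ℂ)) := by
      refine tendsto_nhdsWithin_iff.mpr ⟨?_, ?_⟩
      · exact (Complex.continuous_ofReal.tendsto' 1 1 (by simp)).mono_left nhdsWithin_le_nhds
      · filter_upwards [self_mem_nhdsWithin] with r hr
        simpa using (ne_of_gt hr)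
    refine ht.frequently (Eventually.frequently ?_)
    filter_upwards [self_mem_nhdsWithin] with r hr
    exact hreal r (one_pos.trans hr)
  rw [← hmgf]
  exact hf.eqOn_of_preconnected_of_frequently_eq hg hU (by simp) hfreq hs

lemma summable_pow_div_Gamma {α : ℝ} (hα0 : 0 < α) (R : ℝ) :
    Summable fun k : ℕ => R ^ k / Gamma (α * k + α) := by
  obtain ⟨M, hM, hMα⟩ : ∃ M > 0, M ^ α = 2 * (|R| + 1) := by
    refine ⟨(2 * (|R| + 1)) ^ α⁻¹, by positivity, ?_⟩
    rw [← rpow_mul (by positivity), inv_mul_cancel₀ hα0.ne', rpow_one]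
  have hGamma (b : ℝ) (hb : 1 ≤ b) : M ^ (b - 1) * exp (-M) ≤ Gamma b := by
    rw [Gamma_eq_integral (by linarith), mul_comm, ← integral_exp_neg_Ioi,
      ← integral_mul_const]
    have hint := GammaIntegral_convergent (s := b) (by linarith)
    refine (setIntegral_mono_on ((integrableOn_exp_neg_Ioi M).mul_const _)
      (hint.mono_set (Set.Ioi_subset_Ioi hM.le)) measurableSet_Ioi fun x hx => ?_).trans
      (setIntegral_mono_set hint ?_ (Set.Ioi_subset_Ioi hM.le).eventuallyLE)
    · have hx' : M ≤ x := le_of_lt hx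
      gcongr
    · filter_upwards [ae_restrict_mem measurableSet_Ioi] with x hx
      exact mul_nonneg (exp_pos _).le (rpow_nonneg (le_of_lt hx) _)
  refine Summable.of_norm_bounded_eventually_nat
    (g := fun k : ℕ => exp M * M ^ (1 - α) * (1 / 2) ^ k)
    ((summable_geometric_of_lt_one (by norm_num) (by norm_num)).mul_left _) ?_
  have hlarge : ∀ᶠ k : ℕ in atTop, 1 ≤ α * k + α :=
    (tendsto_atTop_add_const_right atTop α
      ((tendsto_natCast_atTop_atTop (R := ℝ)).const_mul_atTop hα0)).eventually_ge_atTop 1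
  filter_upwards [hlarge] with k hk
  have h1 := hGamma _ hk
  have h2 : M ^ (α * k + α - 1) = (2 * (|R| + 1)) ^ k * M ^ (α - 1) := by
    rw [← hMα, ← rpow_natCast, ← rpow_mul hM.le, ← rpow_add hM]
    ring_nf
  have h3 : M ^ (1 - α) * M ^ (α - 1) = 1 := by
    rw [← rpow_add hM]; simp
  have h4 : exp M * exp (-M) = 1 := by rw [← exp_add]; simp
  have h5 : (1 / 2 : ℝ) ^ k * 2 ^ k = 1 := by rw [← mul_pow]; norm_num
  have hpos : 0 < Gamma (α * k + α) := Gamma_pos_of_pos (by linarith)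
  rw [norm_div, norm_pow, norm_eq_abs, norm_of_nonneg hpos.le, div_le_iff₀ hpos]
  calc |R| ^ k ≤ (|R| + 1) ^ k := by gcongr; linarith
    _ = exp M * M ^ (1 - α) * (1 / 2) ^ k * (M ^ (α * k + α - 1) * exp (-M)) := by
      rw [h2, mul_pow]
      have h6 : exp M * M ^ (1 - α) * (1 / 2) ^ k *
          (2 ^ k * (|R| + 1) ^ k * M ^ (α - 1) * exp (-M))
          = (exp M * exp (-M)) * (M ^ (1 - α) * M ^ (α - 1)) * ((1 / 2) ^ k * 2 ^ k) *
            (|R| + 1) ^ k := by ring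
      rw [h6, h3, h4, h5, one_mul, one_mul, one_mul]
    _ ≤ _ := by gcongr

/-- The function `σ ^ (α - 1) * E_{α,α}(m * σ ^ α)`, with `E` the Mittag-Leffler function. -/
noncomputable def mittagLefflerKernel (α m σ : ℝ) : ℝ :=
  σ ^ (α - 1) * ∑' k : ℕ, (m * σ ^ α) ^ k / Gamma (α * k + α)

lemma continuousOn_mittagLefflerKernel {α : ℝ} (hα0 : 0 < α) (m : ℝ) :
    ContinuousOn (mittagLefflerKernel α m) (Set.Ioi 0) := by
  have hE : Continuous fun x : ℝ => ∑' k : ℕ, x ^ k / Gamma (α * k + α) := by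
    refine continuous_iff_continuousAt.mpr fun x => ?_
    have hx : Set.Icc (-(|x| + 1)) (|x| + 1) ∈ nhds x :=
      Icc_mem_nhds (by linarith [neg_abs_le x]) (by linarith [le_abs_self x])
    refine ContinuousOn.continuousAt (continuousOn_tsum (fun k => by fun_prop)
      (summable_pow_div_Gamma hα0 (|x| + 1)) fun k y hy => ?_) hx
    have hpos : 0 < Gamma (α * k + α) := Gamma_pos_of_pos (by positivity)
    rw [norm_div, norm_pow, norm_of_nonneg hpos.le]
    gcongr
    exact abs_le.mpr hy
  have hpow (p : ℝ) : ContinuousOn (fun σ : ℝ => σ ^ p) (Set.Ioi 0) := fun σ hσ =>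
    (continuousAt_rpow_const _ _ (Or.inl (ne_of_gt hσ))).continuousWithinAt
  exact (hpow _).mul (hE.comp_continuousOn ((hpow α).const_mul m))

lemma integral_mittagLefflerKernel_mul_cexp {α : ℝ} (hα0 : 0 < α) {m : ℝ} {s : ℂ}
    (hs : 0 < s.re) (hm : |m| < s.re ^ α) :
    ∫ σ in Set.Ioi (0 : ℝ), (mittagLefflerKernel α m σ : ℂ) * Complex.exp (-(s * σ))
      = (s ^ (α : ℂ) - m)⁻¹ := by
  have hs0 : s ≠ 0 := fun h => by simp [h] at hs
  have hb (k : ℕ) : 0 < α * k + α := by positivity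
  set F : ℕ → ℝ → ℂ := fun k σ => ((m ^ k / Gamma (α * k + α) : ℝ) : ℂ) *
    (((σ ^ (α * k + α - 1) : ℝ) : ℂ) * Complex.exp (-(s * σ))) with hF
  have hnorm (k : ℕ) {σ : ℝ} (hσ : σ ∈ Set.Ioi (0 : ℝ)) : ‖F k σ‖ =
      |m| ^ k / Gamma (α * k + α) * (σ ^ (α * k + α - 1) * exp (-(s.re * σ))) := by
    have hσ' : 0 < σ := hσ
    simp only [hF]
    rw [norm_mul, norm_mul, Complex.norm_exp, Complex.norm_real, Complex.norm_real, norm_div,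
      norm_pow, norm_of_nonneg (Gamma_pos_of_pos (hb k)).le,
      norm_of_nonneg (rpow_nonneg hσ'.le (α * k + α - 1))]
    simp
  have hFint (k : ℕ) : IntegrableOn (F k) (Set.Ioi 0) := by
    have h1 := integrableOn_rpow_mul_exp_neg_mul_rpow (s := α * k + α - 1) (p := 1)
      (by linarith [hb k]) one_pos hs
    refine Integrable.mono' (h1.const_mul (|m| ^ k / Gamma (α * k + α))) ?_ ?_
    · exact Measurable.aestronglyMeasurable (by fun_prop)
    · filter_upwards [ae_restrict_mem measurableSet_Ioi] with σ hσ
      rw [hnorm k hσ, rpow_one, neg_mul]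
  have hFnorm (k : ℕ) : ∫ σ in Set.Ioi (0 : ℝ), ‖F k σ‖
      = (s.re ^ α)⁻¹ * (|m| * (s.re ^ α)⁻¹) ^ k := by
    rw [setIntegral_congr_fun measurableSet_Ioi fun σ hσ => hnorm k hσ, integral_const_mul,
      integral_rpow_mul_exp_neg_mul_Ioi (hb k) hs, one_div, inv_rpow hs.le, rpow_add hs,
      rpow_mul hs.le, rpow_natCast]
    have := (Gamma_pos_of_pos (hb k)).ne'
    rw [mul_pow, inv_pow, mul_inv]
    field_simp
  have hsum : Summable fun k => ∫ σ in Set.Ioi (0 : ℝ), ‖F k σ‖ := by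
    simp only [hFnorm]
    refine (summable_geometric_of_lt_one (by positivity) ?_).mul_left _
    rw [← div_eq_mul_inv, div_lt_one (by positivity)]
    exact hm
  have hFval (k : ℕ) : ∫ σ in Set.Ioi (0 : ℝ), F k σ
      = (s ^ (α : ℂ))⁻¹ * (m * (s ^ (α : ℂ))⁻¹) ^ k := by
    have h2 : s ^ (-((α * k + α : ℝ) : ℂ)) = ((s ^ (α : ℂ)) ^ k * s ^ (α : ℂ))⁻¹ := by
      push_cast
      rw [Complex.cpow_neg, Complex.cpow_add _ _ hs0, Complex.cpow_mul_nat]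
    rw [hF, integral_const_mul, integral_rpow_mul_cexp_neg_mul_Ioi (hb k) hs, h2]
    have h3 : ((Gamma (α * k + α) : ℝ) : ℂ) ≠ 0 := by
      exact_mod_cast (Gamma_pos_of_pos (hb k)).ne'
    generalize Gamma (α * k + α) = G at h3 ⊢
    rw [mul_pow, inv_pow, mul_inv, Complex.ofReal_div]
    push_cast
    field_simp
  have hsα : |m| < ‖s ^ (α : ℂ)‖ := by
    rw [Complex.norm_cpow_real]
    exact hm.trans_le (rpow_le_rpow hs.le (Complex.re_le_norm s) hα0.le)
  have hsα0 : s ^ (α : ℂ) ≠ 0 := norm_pos_iff.mp ((abs_nonneg m).trans_lt hsα)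
  have hgeom : HasSum (fun k => ∫ σ in Set.Ioi (0 : ℝ), F k σ) (s ^ (α : ℂ) - m)⁻¹ := by
    simp only [hFval]
    have h4 : ‖(m : ℂ) * (s ^ (α : ℂ))⁻¹‖ < 1 := by
      rw [norm_mul, norm_inv, Complex.norm_real, norm_eq_abs, ← div_eq_mul_inv,
        div_lt_one (norm_pos_iff.mpr hsα0)]
      exact hsα
    have h5 := (hasSum_geometric_of_norm_lt_one h4).mul_left (s ^ (α : ℂ))⁻¹
    rwa [← mul_inv, mul_sub, mul_one, mul_left_comm, mul_inv_cancel₀ hsα0, mul_one] at h5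
  rw [hgeom.unique (hasSum_integral_of_summable_integral_norm hFint hsum)]
  refine setIntegral_congr_fun measurableSet_Ioi fun σ hσ => ?_
  have hσ' : 0 < σ := hσ
  simp only [hF, mittagLefflerKernel, ← mul_assoc]
  rw [tsum_mul_right, ← tsum_mul_left, Complex.ofReal_tsum]
  congr 2
  ext k
  rw [← Complex.ofReal_mul]
  congr 1
  rw [mul_pow, ← rpow_natCast (σ ^ α), ← rpow_mul hσ'.le, add_sub_assoc, rpow_add hσ']
  ring

lemma integrableOn_mittagLefflerKernel_mul_exp {α : ℝ} (hα0 : 0 < α) {m c : ℝ}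
    (hc : 0 < c) (hm : |m| < c ^ α) :
    IntegrableOn (fun σ : ℝ => (mittagLefflerKernel α m σ : ℂ) * Complex.exp (-(c * σ)))
      (Set.Ioi 0) := by
  have hdom : IntegrableOn
      (fun σ : ℝ => (mittagLefflerKernel α |m| σ : ℂ) * Complex.exp (-((c : ℂ) * σ)))
      (Set.Ioi 0) := by
    refine Integrable.of_integral_ne_zero ?_
    rw [integral_mittagLefflerKernel_mul_cexp hα0 (by simpa using hc) (by simpa using hm),
      ← Complex.ofReal_cpow hc.le, ← Complex.ofReal_sub]
    exact inv_ne_zero (Complex.ofReal_ne_zero.mpr (sub_pos.mpr hm).ne')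
  refine Integrable.mono hdom (ContinuousOn.aestronglyMeasurable ?_ measurableSet_Ioi) ?_
  · exact (Complex.continuous_ofReal.comp_continuousOn
      (continuousOn_mittagLefflerKernel hα0 m)).mul (by fun_prop)
  · filter_upwards [ae_restrict_mem measurableSet_Ioi] with σ hσ
    have hσ' : 0 < σ := hσ
    rw [norm_mul, norm_mul]
    gcongr
    rw [Complex.norm_real, Complex.norm_real, mittagLefflerKernel, mittagLefflerKernel, norm_mul,
      norm_mul]
    gcongr
    refine (tsum_of_norm_bounded (summable_pow_div_Gamma hα0 (|m| * σ ^ α)).hasSum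
      fun k => ?_).trans (le_norm_self _)
    rw [norm_div, norm_pow, norm_mul, norm_of_nonneg (rpow_nonneg hσ'.le _),
      norm_of_nonneg (Gamma_pos_of_pos (by positivity : 0 < α * k + α)).le, norm_eq_abs]

lemma exp_mul_add_ne_zero {α l : ℝ} (hl : 0 < l) {w : ℂ} (h : |α * w.im| < π) :
    Complex.exp (α * w) + l ≠ 0 := by
  intro h0
  have h1 : Complex.exp (α * w) = ((-l : ℝ) : ℂ) := by
    push_cast; linear_combination h0
  have him : ((α : ℂ) * w).im = α * w.im := by simp
  have h2 := Complex.log_exp (x := α * w) (by rw [him]; exact (abs_lt.mp h).1)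
    (by rw [him]; exact (abs_lt.mp h).2.le)
  have h3 := congrArg Complex.im h2
  rw [h1, Complex.log_im, Complex.arg_ofReal_of_neg (by linarith), him] at h3
  exact absurd h3.symm (abs_lt.mp h).2.ne

lemma Complex.eq_of_exp_eq_of_abs_im_sub_lt {w z : ℂ} (h : Complex.exp w = Complex.exp z)
    (him : |w.im - z.im| < 2 * π) : w = z := by
  obtain ⟨n, hn⟩ := Complex.exp_eq_exp_iff_exists_int.mp h
  have h1 : w.im - z.im = n * (2 * π) := by rw [hn]; simp
  rw [h1, abs_mul, abs_of_pos two_pi_pos] at him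
  have h2 : |(n : ℝ)| < 1 := by
    by_contra! h3
    nlinarith [two_pi_pos]
  have h3 : n = 0 := by
    rw [← Int.abs_lt_one_iff]
    exact_mod_cast h2
  simpa [h3] using hn

open Topology in
lemma tendsto_integral_vertical {g : ℂ → ℂ} {c : ℂ} {l : Filter ℝ} {a b : ℝ}
    (hg : Tendsto g (comap Complex.re l) (𝓝 c))
    (hcont : ∀ T : ℝ, ContinuousOn (fun y : ℝ => g (T + y * Complex.I)) (Set.uIcc a b)) :
    Tendsto (fun T : ℝ => ∫ y in a..b, g (T + y * Complex.I)) l (𝓝 ((b - a) * c)) := by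
  rw [Metric.tendsto_nhds]
  intro ε hε
  have hδ : 0 < ε / (|b - a| + 1) := by positivity
  have h := (Metric.tendsto_nhds.mp hg _ hδ)
  rw [eventually_comap] at h
  filter_upwards [h] with T hT
  have h1 : ∫ y in a..b, (g (T + y * Complex.I) - c)
      = (∫ y in a..b, g (T + y * Complex.I)) - (b - a) * c := by
    rw [intervalIntegral.integral_sub (hcont T).intervalIntegrable (by simp)]
    simp
  rw [dist_eq_norm, ← h1]
  refine lt_of_le_of_lt (intervalIntegral.norm_integral_le_of_norm_le_const
    (C := ε / (|b - a| + 1)) fun y _ => ?_) ?_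
  · have := hT (T + y * Complex.I) (by simp)
    rw [dist_eq_norm] at this
    exact this.le
  · rw [div_mul_eq_mul_div, div_lt_iff₀ (by positivity)]
    nlinarith [abs_nonneg (b - a)]

/-- The spectral density, in the logarithmic variable `u`, of `(s ^ α + l)⁻¹`. -/
noncomputable def spectralKernel (α l u : ℝ) : ℝ :=
  sin (π * α) / π * exp (α * u) /
    (l ^ 2 + 2 * l * exp (α * u) * cos (π * α) + exp (α * u) ^ 2)

lemma exp_add_mul_pi_I (α u : ℝ) :
    Complex.exp (α * (u + π * Complex.I))
      = exp (α * u) * (cos (π * α) + sin (π * α) * Complex.I) := by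
  rw [mul_add, Complex.exp_add]
  push_cast
  rw [← Complex.exp_mul_I]
  ring_nf

lemma exp_sub_mul_pi_I (α u : ℝ) :
    Complex.exp (α * (u - π * Complex.I))
      = exp (α * u) * (cos (π * α) - sin (π * α) * Complex.I) := by
  rw [mul_sub, sub_eq_add_neg, Complex.exp_add]
  have h := Complex.exp_mul_I (-(π * α))
  rw [Complex.cos_neg, Complex.sin_neg] at h
  have h' : -((α : ℂ) * (π * Complex.I)) = -(π * α) * Complex.I := by ring
  push_cast
  rw [h', h]
  ring

lemma spectralKernel_denom_pos {α l : ℝ} (hα0 : 0 < α) (hα1 : α < 1) {r : ℝ}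
    (hr : 0 < r) : 0 < l ^ 2 + 2 * l * r * cos (π * α) + r ^ 2 := by
  have hs : 0 < sin (π * α) :=
    sin_pos_of_pos_of_lt_pi (by positivity) (by nlinarith [pi_pos])
  have : l ^ 2 + 2 * l * r * cos (π * α) + r ^ 2
      = (l + r * cos (π * α)) ^ 2 + (r * sin (π * α)) ^ 2 := by
    linear_combination -r ^ 2 * sin_sq_add_cos_sq (π * α)
  rw [this]
  positivity

lemma resolvent_sub_resolvent {α l : ℝ} (hα0 : 0 < α) (hα1 : α < 1) (hl : 0 < l) (u : ℝ) :
    (Complex.exp (α * (u - π * Complex.I)) + l)⁻¹ - (Complex.exp (α * (u + π * Complex.I)) + l)⁻¹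
      = 2 * π * Complex.I * spectralKernel α l u := by
  have hπ : |α * π| < π := by
    rw [abs_of_pos (by positivity)]; nlinarith [pi_pos]
  have h1 : Complex.exp (α * (u - π * Complex.I)) + l ≠ 0 :=
    exp_mul_add_ne_zero hl (by simpa using hπ)
  have h2 : Complex.exp (α * (u + π * Complex.I)) + l ≠ 0 :=
    exp_mul_add_ne_zero hl (by simpa using hπ)
  have h3 := (spectralKernel_denom_pos (l := l) hα0 hα1 (exp_pos (α * u))).ne'
  have hmul : (Complex.exp (α * (u - π * Complex.I)) + l)
      * (Complex.exp (α * (u + π * Complex.I)) + l)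
      = ((l ^ 2 + 2 * l * exp (α * u) * cos (π * α) + exp (α * u) ^ 2 : ℝ) : ℂ) := by
    rw [exp_sub_mul_pi_I, exp_add_mul_pi_I]
    have h5 : ((sin (π * α) : ℝ) : ℂ) ^ 2 + ((cos (π * α) : ℝ) : ℂ) ^ 2 = 1 := by
      exact_mod_cast sin_sq_add_cos_sq (π * α)
    push_cast at h5 ⊢
    linear_combination Complex.exp (α * u) ^ 2 * h5
      - Complex.exp (α * u) ^ 2 * Complex.sin (π * α) ^ 2 * Complex.I_sq
  rw [inv_sub_inv h1 h2, hmul, spectralKernel, div_eq_iff (by exact_mod_cast h3),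
    exp_sub_mul_pi_I, exp_add_mul_pi_I]
  have hπ' : (π : ℂ) ≠ 0 := by exact_mod_cast pi_ne_zero
  have h3' := (Complex.ofReal_ne_zero).mpr h3
  rw [Complex.ofReal_div, mul_assoc, div_mul_cancel₀ _ h3']
  push_cast
  field_simp
  ring

lemma continuous_spectralKernel {α l : ℝ} (hα0 : 0 < α) (hα1 : α < 1) :
    Continuous (spectralKernel α l) := by
  unfold spectralKernel
  exact Continuous.div (by fun_prop) (by fun_prop) fun u =>
    (spectralKernel_denom_pos hα0 hα1 (exp_pos _)).ne'

lemma integrable_spectralKernel {α l : ℝ} (hα0 : 0 < α) (hα1 : α < 1) (hl : 0 < l) :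
    Integrable (spectralKernel α l) := by
  have hs : 0 < sin (π * α) :=
    sin_pos_of_pos_of_lt_pi (by positivity) (by nlinarith [pi_pos])
  obtain ⟨c, hc, hcos⟩ : ∃ c > 0, |cos (π * α)| ≤ 1 - c := by
    refine ⟨1 - |cos (π * α)|, ?_, by linarith⟩
    have : |cos (π * α)| < 1 := by
      rw [← sq_lt_one_iff_abs_lt_one]
      nlinarith [sin_sq_add_cos_sq (π * α)]
    linarith
  have hden (r : ℝ) (hr : 0 < r) :
      c * (l ^ 2 + r ^ 2) ≤ l ^ 2 + 2 * l * r * cos (π * α) + r ^ 2 := by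
    have h1 := neg_abs_le (cos (π * α))
    have h2 : 0 < l * r := by positivity
    nlinarith [mul_le_mul_of_nonneg_left (show -(1 - c) ≤ cos (π * α) by linarith) h2.le,
      mul_nonneg (show 0 ≤ 1 - c by linarith [abs_nonneg (cos (π * α))]) (sq_nonneg (l - r))]
  have hnorm (u : ℝ) : ‖spectralKernel α l u‖ ≤
      sin (π * α) / π * exp (α * u) / (c * (l ^ 2 + exp (α * u) ^ 2)) := by
    have := spectralKernel_denom_pos (l := l) hα0 hα1 (exp_pos (α * u))
    rw [spectralKernel, norm_of_nonneg (by positivity)]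
    gcongr
    exact hden _ (exp_pos _)
  have hmeas := (continuous_spectralKernel (l := l) hα0 hα1).aestronglyMeasurable (μ := volume)
  rw [← integrableOn_univ, ← Set.Iic_union_Ioi (a := (0 : ℝ)), integrableOn_union]
  constructor
  · refine Integrable.mono' ((integrableOn_exp_mul_Iic hα0 0).const_mul
      (sin (π * α) / π / (c * l ^ 2))) hmeas.restrict (ae_of_all _ fun u => (hnorm u).trans ?_)
    rw [div_mul_eq_mul_div]
    refine (div_le_div_of_nonneg_left (c := c * l ^ 2) (by positivity) (by positivity) ?_).trans_eq
      (by ring)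
    gcongr
    exact le_add_of_nonneg_right (sq_nonneg _)
  · refine Integrable.mono' ((integrableOn_exp_mul_Ioi (neg_lt_zero.mpr hα0) 0).const_mul
      (sin (π * α) / π / c)) hmeas.restrict (ae_of_all _ fun u => (hnorm u).trans ?_)
    have hE := exp_pos (α * u)
    rw [neg_mul, exp_neg, ← div_eq_mul_inv, div_div, div_le_div_iff₀ (by positivity) (by positivity)]
    have := mul_nonneg (mul_pos (div_pos hs pi_pos) hc).le (sq_nonneg l)
    linarith

lemma norm_div_add_le_one {r : ℝ} (hr : 0 < r) {s : ℂ} (hs : 0 ≤ s.re) :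
    ‖(r : ℂ) / (r + s)‖ ≤ 1 := by
  have h : r ≤ ‖(r : ℂ) + s‖ := by
    refine le_trans ?_ (Complex.re_le_norm _)
    simpa using hs
  rw [norm_div, Complex.norm_of_nonneg hr.le]
  exact div_le_one_of_le₀ h (norm_nonneg _)

lemma ofReal_add_ne_zero {r : ℝ} (hr : 0 < r) {s : ℂ} (hs : 0 ≤ s.re) : (r : ℂ) + s ≠ 0 := by
  intro h
  have := congrArg Complex.re h
  simp at this
  linarith

lemma integrable_spectralKernel_mul_div {α l : ℝ} (hα0 : 0 < α) (hα1 : α < 1) (hl : 0 < l)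
    {s : ℂ} (hs : 0 ≤ s.re) :
    Integrable fun u : ℝ => (spectralKernel α l u : ℂ) * ((exp u : ℝ) / ((exp u : ℝ) + s)) := by
  refine (integrable_spectralKernel hα0 hα1 hl).ofReal.mul_bdd (c := 1) ?_
    (ae_of_all _ fun u => norm_div_add_le_one (exp_pos u) hs)
  refine Continuous.aestronglyMeasurable (Continuous.div (by fun_prop) (by fun_prop) fun u => ?_)
  exact ofReal_add_ne_zero (exp_pos u) hs

open Topology in
theorem integral_spectralKernel_mul_div {α l : ℝ} (hα0 : 0 < α) (hα1 : α < 1) (hl : 0 < l)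
    {z : ℂ} (hz : |z.im| ≤ π / 2) :
    ∫ u : ℝ, (spectralKernel α l u : ℂ) * ((exp u : ℝ) / ((exp u : ℝ) + Complex.exp z))
      = (Complex.exp (α * z) + l)⁻¹ := by
  have hs : 0 ≤ (Complex.exp z).re := by
    rw [Complex.exp_re]
    exact mul_nonneg (exp_pos _).le (cos_nonneg_of_mem_Icc (abs_le.mp hz))
  set h : ℂ → ℂ := fun w => (Complex.exp (α * w) + l)⁻¹ with hh
  set g : ℂ → ℂ := fun w => dslope h z w / dslope Complex.exp z w * Complex.exp w with hg
  set S : Set ℂ := {w | |α * w.im| < π ∧ |w.im - z.im| < 2 * π} with hS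
  have hSo : IsOpen S := by
    exact (isOpen_lt (f := fun w : ℂ => |α * w.im|) (by fun_prop) continuous_const).inter
      (isOpen_lt (f := fun w : ℂ => |w.im - z.im|) (by fun_prop) continuous_const)
  have hzS : z ∈ S := by
    refine ⟨?_, by simp [pi_pos]⟩
    rw [abs_mul, abs_of_pos hα0]
    nlinarith [pi_pos, abs_nonneg z.im]
  have hbox {w : ℂ} (hw : |w.im| ≤ π) : w ∈ S := by
    constructor
    · rw [abs_mul, abs_of_pos hα0]
      nlinarith [pi_pos, abs_nonneg w.im]
    · linarith [abs_sub w.im z.im, pi_pos]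
  have hne {w : ℂ} (hw : w ∈ S) : Complex.exp (α * w) + l ≠ 0 := exp_mul_add_ne_zero hl hw.1
  have hinj {w : ℂ} (hw : w ∈ S) (hwz : w ≠ z) : Complex.exp w - Complex.exp z ≠ 0 := fun h0 =>
    hwz (Complex.eq_of_exp_eq_of_abs_im_sub_lt (sub_eq_zero.mp h0) hw.2)
  have hform {w : ℂ} (hw : w ≠ z) :
      g w = (h w - h z) * (Complex.exp w / (Complex.exp w - Complex.exp z)) := by
    have : w - z ≠ 0 := sub_ne_zero.mpr hw
    simp only [hg, dslope_of_ne _ hw, slope_def_field]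
    rw [div_div_div_cancel_right₀ this]
    ring
  have hgd : DifferentiableOn ℂ g S := by
    refine DifferentiableOn.mul (DifferentiableOn.div ?_ ?_ ?_)
      Complex.differentiable_exp.differentiableOn
    · rw [Complex.differentiableOn_dslope (hSo.mem_nhds hzS)]
      exact DifferentiableOn.inv (by fun_prop) fun w hw => hne hw
    · rw [Complex.differentiableOn_dslope (hSo.mem_nhds hzS)]
      exact Complex.differentiable_exp.differentiableOn
    · intro w hw
      by_cases hwz : w = z
      · simp [hwz, dslope_same]
      · rw [dslope_of_ne _ hwz, slope_def_field]
        exact div_ne_zero (hinj hw hwz) (sub_ne_zero.mpr hwz)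
  have hcont (T : ℝ) : ContinuousOn (fun y : ℝ => g (T + y * Complex.I)) (Set.uIcc (-π) π) := by
    refine hgd.continuousOn.comp (by fun_prop) fun y hy => hbox ?_
    rw [Set.uIcc_of_le (by linarith [pi_pos])] at hy
    simpa using abs_le.mpr hy
  have hcontH {b : ℝ} (hb : |b| ≤ π) (T : ℝ) :
      ContinuousOn (fun u : ℝ => g (u + b * Complex.I)) (Set.uIcc (-T) T) :=
    hgd.continuousOn.comp (by fun_prop) fun y _ => hbox (by simpa using hb)
  have hexp0 : Tendsto Complex.exp (comap Complex.re atBot) (𝓝 0) :=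
    tendsto_zero_iff_norm_tendsto_zero.mpr <| by
      simp only [Complex.norm_exp]
      exact tendsto_exp_atBot.comp tendsto_comap
  have hα0' : Tendsto (fun w : ℂ => α * w) (comap Complex.re atBot) (comap Complex.re atBot) := by
    rw [tendsto_comap_iff]
    simpa [Function.comp_def] using tendsto_comap.const_mul_atBot hα0
  have hneg : Tendsto (fun w : ℂ => -w) (comap Complex.re atTop) (comap Complex.re atBot) := by
    rw [tendsto_comap_iff]
    exact tendsto_neg_atTop_atBot.comp tendsto_comap
  have hbot : Tendsto g (comap Complex.re atBot) (𝓝 0) := by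
    have h1 : Tendsto (fun w => (h w - h z) * (Complex.exp w / (Complex.exp w - Complex.exp z)))
        (comap Complex.re atBot)
        (𝓝 ((((0 + l : ℂ))⁻¹ - h z) * (0 / (0 - Complex.exp z)))) := by
      refine Tendsto.mul (Tendsto.sub_const (Tendsto.inv₀ ((hexp0.comp hα0').add_const _) ?_) _)
        (hexp0.div (hexp0.sub_const _) ?_)
      · simpa using hl.ne'
      · simp
    simp only [zero_div, mul_zero] at h1
    refine h1.congr' ?_
    filter_upwards [tendsto_comap.eventually (eventually_lt_atBot z.re)] with w hw
    exact (hform (by rintro rfl; exact lt_irrefl _ hw)).symm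
  have htop : Tendsto g (comap Complex.re atTop) (𝓝 (-h z)) := by
    have h1 : Tendsto (fun w => (Complex.exp (α * -w) / (1 + l * Complex.exp (α * -w)) - h z) *
        (1 / (1 - Complex.exp z * Complex.exp (-w))))
        (comap Complex.re atTop)
        (𝓝 ((0 / (1 + l * 0) - h z) * (1 / (1 - Complex.exp z * 0)))) := by
      have h2 := (hexp0.comp (hα0'.comp hneg))
      have h3 := (hexp0.comp hneg)
      refine Tendsto.mul (Tendsto.sub_const (h2.div ((h2.const_mul _).const_add _) ?_) _)
        (tendsto_const_nhds.div ((h3.const_mul _).const_sub _) ?_) <;> simp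
    simp only [zero_div, mul_zero, sub_zero, zero_sub, div_one, mul_one] at h1
    refine h1.congr' ?_
    filter_upwards [tendsto_comap.eventually (eventually_gt_atTop z.re)] with w hw
    have e2 := Complex.exp_ne_zero (α * w)
    have e3 := Complex.exp_ne_zero w
    have e4 : Complex.exp (α * -w) / (1 + l * Complex.exp (α * -w)) = h w := by
      simp only [hh]
      rw [mul_neg, Complex.exp_neg, div_eq_mul_inv, ← mul_inv, mul_add, mul_one, mul_left_comm,
        mul_inv_cancel₀ e2, mul_one]
    have e5 : 1 / (1 - Complex.exp z * Complex.exp (-w))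
        = Complex.exp w / (Complex.exp w - Complex.exp z) := by
      rw [← mul_div_mul_left 1 _ e3, mul_sub, mul_one, mul_left_comm, ← Complex.exp_add,
        add_neg_cancel, Complex.exp_zero, mul_one]
    rw [hform (by rintro rfl; exact lt_irrefl _ hw), e4, e5]
  have hdiff (u : ℝ) : g (u + (-π : ℝ) * Complex.I) - g (u + π * Complex.I)
      = 2 * π * Complex.I * ((spectralKernel α l u : ℂ) *
          ((exp u : ℝ) / ((exp u : ℝ) + Complex.exp z))) := by
    have hz' := abs_le.mp hz
    have n1 : (u : ℂ) + (-π : ℝ) * Complex.I ≠ z := by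
      rintro rfl
      simp at hz'
      linarith [pi_pos]
    have n2 : (u : ℂ) + π * Complex.I ≠ z := by
      rintro rfl
      simp at hz'
      linarith [pi_pos]
    have x1 : Complex.exp (u + (-π : ℝ) * Complex.I) = -Complex.exp u := by
      rw [Complex.exp_add]; simp [Complex.exp_neg]
    have x2 : Complex.exp (u + π * Complex.I) = -Complex.exp u := by
      rw [Complex.exp_add]; simp
    have x3 : -Complex.exp u / (-Complex.exp u - Complex.exp z)
        = Complex.exp u / (Complex.exp u + Complex.exp z) := by
      rw [← neg_add', neg_div_neg_eq]
    have x4 := resolvent_sub_resolvent hα0 hα1 hl u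
    have x5 : (u : ℂ) + (-π : ℝ) * Complex.I = u - π * Complex.I := by push_cast; ring
    rw [hform n1, hform n2, x1, x2, x3, ← sub_mul, sub_sub_sub_cancel_right, x5]
    simp only [hh]
    rw [x4, Complex.ofReal_exp, mul_assoc]
  have hrect (T : ℝ) (hT : 0 ≤ T) :
      (∫ u in (-T)..T, 2 * π * Complex.I * ((spectralKernel α l u : ℂ) *
          ((exp u : ℝ) / ((exp u : ℝ) + Complex.exp z))))
        + Complex.I * (∫ y in (-π)..π, g (T + y * Complex.I))
        - Complex.I * (∫ y in (-π)..π, g ((-T : ℝ) + y * Complex.I)) = 0 := by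
    have hI := Complex.integral_boundary_rect_eq_zero_of_differentiableOn g
      ((-T : ℝ) + (-π : ℝ) * Complex.I) (T + π * Complex.I) (hgd.mono fun w hw => hbox ?_)
    · simp only [Complex.add_re, Complex.ofReal_re, Complex.mul_re, Complex.I_re, mul_zero,
        Complex.ofReal_im, Complex.I_im, mul_one, sub_self, add_zero, Complex.add_im,
        Complex.mul_im, zero_add, smul_eq_mul] at hI
      rw [← hI, ← intervalIntegral.integral_sub]
      · congr 3
        ext u
        exact (hdiff u).symm
      · exact (hcontH (by simp [abs_of_pos pi_pos]) T).intervalIntegrable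
      · exact (hcontH (by simp [abs_of_pos pi_pos]) T).intervalIntegrable
    · rw [Complex.mem_reProdIm] at hw
      have := hw.2
      simp only [Complex.ofReal_re, Complex.I_re, mul_zero,
        Complex.ofReal_im, Complex.I_im, mul_one, Complex.add_im,
        Complex.mul_im, zero_add, add_zero] at this
      rw [Set.uIcc_of_le (by linarith [pi_pos])] at this
      exact abs_le.mpr this
  have hint := integrable_spectralKernel_mul_div hα0 hα1 hl hs
  have hlim : Tendsto (fun T : ℝ =>
      (∫ u in (-T)..T, 2 * π * Complex.I * ((spectralKernel α l u : ℂ) *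
          ((exp u : ℝ) / ((exp u : ℝ) + Complex.exp z))))
        + Complex.I * (∫ y in (-π)..π, g (T + y * Complex.I))
        - Complex.I * (∫ y in (-π)..π, g ((-T : ℝ) + y * Complex.I))) atTop
      (𝓝 ((∫ u, 2 * π * Complex.I * ((spectralKernel α l u : ℂ) *
          ((exp u : ℝ) / ((exp u : ℝ) + Complex.exp z))))
        + Complex.I * ((((π : ℝ) : ℂ) - ((-π : ℝ) : ℂ)) * -h z)
        - Complex.I * ((((π : ℝ) : ℂ) - ((-π : ℝ) : ℂ)) * 0))) := by
    refine Tendsto.sub (Tendsto.add ?_ ?_) ?_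
    · exact intervalIntegral_tendsto_integral (hint.const_mul _) tendsto_neg_atTop_atBot tendsto_id
    · exact (tendsto_integral_vertical htop hcont).const_mul _
    · exact ((tendsto_integral_vertical hbot hcont).comp tendsto_neg_atTop_atBot).const_mul _
  have hfin := tendsto_nhds_unique hlim (tendsto_const_nhds.congr' (by
    filter_upwards [eventually_ge_atTop 0] with T hT using (hrect T hT).symm))
  rw [integral_const_mul] at hfin
  have hne2 : 2 * (π : ℂ) * Complex.I ≠ 0 := Complex.two_pi_I_ne_zero
  refine mul_left_cancel₀ hne2 ?_
  rw [hh] at hfin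
  push_cast at hfin ⊢
  linear_combination hfin

/-- The superposition of decaying exponentials with density `spectralKernel α l`. -/
noncomputable def spectralFunction (α l σ : ℝ) : ℝ :=
  ∫ u : ℝ, spectralKernel α l u * exp u * exp (-(exp u * σ))

lemma integrable_spectralKernel_prod {α l : ℝ} (hα0 : 0 < α) (hα1 : α < 1) (hl : 0 < l)
    {s : ℂ} (hs : 0 ≤ s.re) :
    Integrable (fun p : ℝ × ℝ => ((spectralKernel α l p.1 * exp p.1 : ℝ) : ℂ) *
      Complex.exp (-((exp p.1 : ℝ) + s) * p.2))
      ((volume : Measure ℝ).prod (volume.restrict (Set.Ioi 0))) := by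
  have hk := continuous_spectralKernel (l := l) hα0 hα1
  have hre (u : ℝ) : (-((exp u : ℝ) + s)).re < 0 := by
    rw [Complex.neg_re, Complex.add_re, Complex.ofReal_re]
    linarith [exp_pos u]
  rw [integrable_prod_iff (Continuous.aestronglyMeasurable (by fun_prop))]
  refine ⟨ae_of_all _ fun u => (integrableOn_exp_mul_complex_Ioi (hre u) 0).const_mul
    ((spectralKernel α l u * exp u : ℝ) : ℂ), ?_⟩
  have hs' : 0 ≤ ((s.re : ℝ) : ℂ).re := hs
  refine (integrable_spectralKernel_mul_div hα0 hα1 hl hs').norm.congr (ae_of_all _ fun u => ?_)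
  have h1 : 0 < exp u + s.re := add_pos_of_pos_of_nonneg (exp_pos u) hs
  have h2 (σ : ℝ) : ‖((spectralKernel α l u * exp u : ℝ) : ℂ) *
      Complex.exp (-((exp u : ℝ) + s) * σ)‖
      = |spectralKernel α l u| * exp u * exp (-(exp u + s.re) * σ) := by
    rw [norm_mul, Complex.norm_exp, Complex.norm_real, norm_mul, norm_eq_abs, norm_eq_abs,
      abs_of_pos (exp_pos u)]
    simp [-Complex.ofReal_exp]
  simp only [h2]
  rw [integral_const_mul, integral_exp_mul_Ioi (by linarith), norm_mul, norm_div,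
    ← Complex.ofReal_add]
  simp only [Complex.norm_real, norm_eq_abs, abs_of_pos (exp_pos u), abs_of_pos h1, mul_zero,
    exp_zero, neg_div_neg_eq]
  ring

lemma spectralFunction_mul_cexp (α l : ℝ) (s : ℂ) (σ : ℝ) :
    (spectralFunction α l σ : ℂ) * Complex.exp (-(s * σ))
      = ∫ u : ℝ, ((spectralKernel α l u * exp u : ℝ) : ℂ) *
          Complex.exp (-((exp u : ℝ) + s) * σ) := by
  rw [spectralFunction, ← integral_complex_ofReal, ← integral_mul_const]
  congr 1
  ext u
  rw [neg_mul, add_mul, neg_add, Complex.exp_add]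
  push_cast
  ring

lemma integrableOn_spectralFunction_mul_cexp {α l : ℝ} (hα0 : 0 < α) (hα1 : α < 1) (hl : 0 < l)
    {s : ℂ} (hs : 0 ≤ s.re) :
    IntegrableOn (fun σ : ℝ => (spectralFunction α l σ : ℂ) * Complex.exp (-(s * σ)))
      (Set.Ioi 0) := by
  simp only [spectralFunction_mul_cexp]
  exact (integrable_spectralKernel_prod hα0 hα1 hl hs).integral_prod_right

theorem integral_spectralFunction_mul_cexp {α l : ℝ} (hα0 : 0 < α) (hα1 : α < 1) (hl : 0 < l)
    {s : ℂ} (hs : 0 ≤ s.re) (hs0 : s ≠ 0) :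
    ∫ σ in Set.Ioi (0 : ℝ), (spectralFunction α l σ : ℂ) * Complex.exp (-(s * σ))
      = (s ^ (α : ℂ) + l)⁻¹ := by
  simp only [spectralFunction_mul_cexp]
  rw [← integral_integral_swap (integrable_spectralKernel_prod hα0 hα1 hl hs)]
  have him : |(Complex.log s).im| ≤ π / 2 := by
    rw [Complex.log_im]
    exact Complex.abs_arg_le_pi_div_two_iff.mpr hs
  have h := integral_spectralKernel_mul_div hα0 hα1 hl him
  rw [Complex.exp_log hs0, mul_comm (α : ℂ), ← Complex.cpow_def_of_ne_zero hs0] at h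
  rw [← h]
  congr 1
  ext u
  have hre : (-((exp u : ℝ) + s)).re < 0 := by
    rw [Complex.neg_re, Complex.add_re, Complex.ofReal_re]
    linarith [exp_pos u]
  rw [integral_const_mul, integral_exp_mul_complex_Ioi hre]
  simp only [Complex.ofReal_zero, mul_zero, Complex.exp_zero, neg_div_neg_eq]
  push_cast
  ring

lemma continuousOn_spectralFunction {α l : ℝ} (hα0 : 0 < α) (hα1 : α < 1) (hl : 0 < l) :
    ContinuousOn (spectralFunction α l) (Set.Ioi 0) := by
  have hk := continuous_spectralKernel (l := l) hα0 hα1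
  intro σ hσ
  have hσ' : 0 < σ := hσ
  refine ContinuousAt.continuousWithinAt ?_
  refine continuousAt_of_dominated
    (bound := fun u => ‖spectralKernel α l u‖ * (2 / σ)) ?_ ?_ ?_ ?_
  · exact Eventually.of_forall fun τ => Continuous.aestronglyMeasurable (by fun_prop)
  · filter_upwards [lt_mem_nhds (half_lt_self hσ')] with τ hτ
    refine ae_of_all _ fun u => ?_
    rw [mul_assoc, norm_mul]
    gcongr
    rw [norm_of_nonneg (by positivity), exp_neg, ← div_eq_mul_inv, div_le_div_iff₀ (exp_pos _) hσ']
    have h1 := add_one_le_exp (exp u * τ)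
    nlinarith [mul_lt_mul_of_pos_left hτ (exp_pos u)]
  · exact (integrable_spectralKernel hα0 hα1 hl).norm.mul_const _
  · exact ae_of_all _ fun u => by fun_prop

open FourierTransform in
lemma eq_zero_of_integral_mul_cexp_eq_zero {d : ℝ → ℂ} (hd : IntegrableOn d (Set.Ioi 0))
    (hc : ContinuousOn d (Set.Ioi 0))
    (h0 : ∀ ξ : ℝ, ∫ σ in Set.Ioi (0 : ℝ), d σ * Complex.exp (-(ξ * Complex.I * σ)) = 0)
    {σ : ℝ} (hσ : 0 < σ) : d σ = 0 := by
  set D : ℝ → ℂ := (Set.Ioi 0).indicator d with hD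
  have hDint : Integrable D := hd.integrable_indicator measurableSet_Ioi
  have hF : 𝓕 D = 0 := by
    ext ξ
    rw [Real.fourier_real_eq_integral_exp_smul, Pi.zero_apply, ← h0 (2 * π * ξ),
      ← integral_indicator measurableSet_Ioi]
    congr 1
    ext v
    by_cases hv : v ∈ Set.Ioi (0 : ℝ)
    · simp only [hD, Set.indicator_of_mem hv, smul_eq_mul]
      rw [mul_comm]
      congr 2
      push_cast
      ring
    · simp [hD, Set.indicator_of_notMem hv]
  have hcont : ContinuousAt D σ := by
    refine (hc.continuousAt (Ioi_mem_nhds hσ)).congr ?_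
    filter_upwards [Ioi_mem_nhds hσ] with τ hτ
    exact (Set.indicator_of_mem hτ d).symm
  have h := hDint.fourierInv_fourier_eq (by rw [hF]; exact integrable_zero _ _ _) hcont
  rw [hF, hD, Set.indicator_of_mem (Set.mem_Ioi.mpr hσ)] at h
  rw [← h, Real.fourierInv_eq]
  simp

lemma mittagLefflerKernel_neg_eq_spectralFunction {α l σ : ℝ} (hα0 : 0 < α) (hα1 : α < 1)
    (hl : 0 < l) (hσ : 0 < σ) :
    mittagLefflerKernel α (-l) σ = spectralFunction α l σ := by
  obtain ⟨c, hc, hlc⟩ : ∃ c : ℝ, 0 < c ∧ l < c ^ α :=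
    ⟨(l + 1) ^ α⁻¹, by positivity, by
      rw [Real.rpow_inv_rpow (by positivity) hα0.ne']; linarith⟩
  have hm : |-l| < c ^ α := by rwa [abs_neg, abs_of_pos hl]
  have hM := integrableOn_mittagLefflerKernel_mul_exp hα0 hc hm
  have hS := integrableOn_spectralFunction_mul_cexp (s := (c : ℂ)) hα0 hα1 hl (by simpa using hc.le)
  have hshift : ∀ (f : ℝ → ℂ) (ξ : ℝ), (fun σ : ℝ => f σ * Complex.exp (-((c + ξ * Complex.I) * σ)))
      = fun σ : ℝ => (f σ * Complex.exp (-(c * σ))) * Complex.exp (-(ξ * Complex.I * σ)) := by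
    intro f ξ
    funext σ
    rw [mul_assoc, ← Complex.exp_add]
    ring_nf
  have hMξ : ∀ ξ : ℝ, IntegrableOn (fun σ : ℝ => ((mittagLefflerKernel α (-l) σ : ℝ) : ℂ) *
      Complex.exp (-((c + ξ * Complex.I) * σ))) (Set.Ioi 0) := by
    intro ξ
    rw [hshift (fun σ => ((mittagLefflerKernel α (-l) σ : ℝ) : ℂ))]
    refine hM.mul_bdd (c := 1) (by fun_prop) (ae_of_all _ fun σ => ?_)
    rw [Complex.norm_exp]
    simp
  have h := eq_zero_of_integral_mul_cexp_eq_zero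
    (d := fun σ : ℝ => (mittagLefflerKernel α (-l) σ : ℂ) * Complex.exp (-(c * σ))
      - (spectralFunction α l σ : ℂ) * Complex.exp (-(c * σ)))
    (hM.sub hS) ?_ ?_ hσ
  · simp only [← sub_mul] at h
    have h' := (mul_eq_zero.1 h).resolve_right (Complex.exp_ne_zero _)
    exact_mod_cast sub_eq_zero.1 h'
  · have h1 := continuousOn_mittagLefflerKernel hα0 (-l)
    have h2 := continuousOn_spectralFunction hα0 hα1 hl
    fun_prop
  · intro ξ
    have hs : 0 < ((c : ℂ) + ξ * Complex.I).re := by simpa using hc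
    have h1 := integral_mittagLefflerKernel_mul_cexp (m := -l) hα0 hs (by simpa using hm)
    have h2 := integral_spectralFunction_mul_cexp hα0 hα1 hl hs.le
      (by rintro h0; simp [h0] at hs)
    rw [show (fun σ : ℝ => ((mittagLefflerKernel α (-l) σ : ℂ) * Complex.exp (-(c * σ))
        - (spectralFunction α l σ : ℂ) * Complex.exp (-(c * σ))) *
          Complex.exp (-(ξ * Complex.I * σ)))
      = fun σ : ℝ => (mittagLefflerKernel α (-l) σ : ℂ) *
          Complex.exp (-((c + ξ * Complex.I) * σ))
        - (spectralFunction α l σ : ℂ) * Complex.exp (-((c + ξ * Complex.I) * σ)) from ?_,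
      integral_sub (hMξ ξ) (integrableOn_spectralFunction_mul_cexp hα0 hα1 hl hs.le), h1, h2]
    · push_cast
      ring
    · funext σ
      rw [sub_mul, ← congrFun (hshift (fun σ => (mittagLefflerKernel α (-l) σ : ℂ)) ξ) σ,
        ← congrFun (hshift (fun σ => (spectralFunction α l σ : ℂ)) ξ) σ]

lemma neg_ofReal_mul_I_cpow {x : ℝ} (hx : 0 < x) (α : ℝ) :
    (-(x * Complex.I)) ^ (α : ℂ)
      = ((x ^ α * Real.cos (α * π / 2) : ℝ) : ℂ)
        - ((x ^ α * Real.sin (α * π / 2) : ℝ) : ℂ) * Complex.I := by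
  rw [show -((x : ℂ) * Complex.I) = (x : ℂ) * (-Complex.I) by ring,
    Complex.cpow_def_of_ne_zero (by simp [hx.ne']),
    Complex.log_ofReal_mul hx (by simp), Complex.log_neg_I, add_mul, Complex.exp_add]
  rw [show -(π / 2) * Complex.I * (α : ℂ) = ((-(α * π / 2) : ℝ) : ℂ) * Complex.I by
    push_cast; ring, Complex.exp_mul_I, ← Complex.ofReal_cos, ← Complex.ofReal_sin,
    Real.cos_neg, Real.sin_neg, Real.rpow_def_of_pos hx]
  push_cast
  ring

lemma mittagLefflerKernel_mul_sin {α l σ : ℝ} (hα0 : 0 < α) (hα1 : α < 1) (hl : 0 < l)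
    (hσ : 0 < σ) (x : ℝ) :
    mittagLefflerKernel α (-l) σ * Real.sin (x * σ)
      = ((spectralFunction α l σ : ℂ) * Complex.exp (-(-(x * Complex.I) * σ))).im := by
  rw [mittagLefflerKernel_neg_eq_spectralFunction hα0 hα1 hl hσ, Complex.im_ofReal_mul,
    show -(-((x : ℂ) * Complex.I) * σ) = ((x * σ : ℝ) : ℂ) * Complex.I by push_cast; ring,
    Complex.exp_ofReal_mul_I_im]

lemma integrableOn_mittagLefflerKernel_mul_sin {α l : ℝ} (hα0 : 0 < α) (hα1 : α < 1)
    (hl : 0 < l) (x : ℝ) :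
    IntegrableOn (fun σ => mittagLefflerKernel α (-l) σ * Real.sin (x * σ)) (Set.Ioi 0) :=
  IntegrableOn.congr_fun (integrableOn_spectralFunction_mul_cexp (s := -(x * Complex.I)) hα0 hα1 hl
    (by simp)).im (fun _ hσ => (mittagLefflerKernel_mul_sin hα0 hα1 hl hσ x).symm)
    measurableSet_Ioi

lemma integral_mittagLefflerKernel_mul_sin {α l x : ℝ} (hα0 : 0 < α) (hα1 : α < 1)
    (hl : 0 < l) (hx : 0 < x) :
    ∫ σ in Set.Ioi (0 : ℝ), mittagLefflerKernel α (-l) σ * Real.sin (x * σ)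
      = x ^ α * Real.sin (α * π / 2) /
        (l ^ 2 + 2 * l * x ^ α * Real.cos (α * π / 2) + (x ^ α) ^ 2) := by
  have hs : 0 ≤ (-((x : ℂ) * Complex.I)).re := by simp
  rw [setIntegral_congr_fun measurableSet_Ioi
      (fun σ hσ => mittagLefflerKernel_mul_sin hα0 hα1 hl hσ x)]
  have him := integral_im (integrableOn_spectralFunction_mul_cexp hα0 hα1 hl hs)
  simp only [RCLike.im_to_complex] at him
  rw [him, integral_spectralFunction_mul_cexp hα0 hα1 hl hs (by simp [hx.ne']),
    neg_ofReal_mul_I_cpow hx, Complex.inv_im]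
  simp only [Complex.normSq_apply, Complex.add_re, Complex.sub_re, Complex.mul_re, Complex.add_im,
    Complex.sub_im, Complex.mul_im, Complex.ofReal_re, Complex.ofReal_im, Complex.I_re,
    Complex.I_im]
  congr 1
  · ring
  · linear_combination (x ^ α) ^ 2 * Real.sin_sq_add_cos_sq (α * π / 2)

/-- For `0 < α < 1`, `x > 0`, `t > 0`, the improper Riemann integral
`∫_0^∞ σ^{α-1} E_{α,α}(-t^α σ^α) sin(xσ) dσ` converges, and multiplied by `t^α/(πx)`
it equals the closed-form neutral-diffusion fundamental solution. -/
theorem mittagLeffler_sine_transform (α x t : ℝ) (hα0 : 0 < α) (hα1 : α < 1)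
    (hx : 0 < x) (ht : 0 < t) :
    ∃ L : ℝ,
      Filter.Tendsto
        (fun R : ℝ => ∫ σ in (0 : ℝ)..R,
          σ ^ (α - 1) * (∑' k : ℕ, (-(t ^ α * σ ^ α)) ^ k / Real.Gamma (α * k + α)) *
            Real.sin (x * σ))
        Filter.atTop (nhds L) ∧
      (t ^ α / (Real.pi * x)) * L
        = (1 / Real.pi) * (t ^ α * x ^ (α - 1) * Real.sin (α * Real.pi / 2)) /
            (t ^ (2 * α) + 2 * t ^ α * x ^ α * Real.cos (α * Real.pi / 2) + x ^ (2 * α)) := by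
  have hl : 0 < t ^ α := Real.rpow_pos_of_pos ht α
  refine ⟨∫ σ in Set.Ioi 0, mittagLefflerKernel α (-t ^ α) σ * Real.sin (x * σ), ?_, ?_⟩
  · simpa only [mittagLefflerKernel, neg_mul, id] using intervalIntegral_tendsto_integral_Ioi 0
      (integrableOn_mittagLefflerKernel_mul_sin hα0 hα1 hl x) tendsto_id
  · rw [integral_mittagLefflerKernel_mul_sin hα0 hα1 hl hx, two_mul α, Real.rpow_add ht,
      Real.rpow_add hx, Real.rpow_sub_one hx.ne', ← sq, ← sq]
    field_simp
end
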